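/- arXiv:1508.02068 — 4 statements merged into one kernel-verified Lean document; each statement's English description precedes it below -/
import Mathlib

section
/- Let Z ∈ ℂ^{n×n} be a Hermitian matrix and let Λ(Z) := [[Re Z, −Im Z],[Im Z, Re Z]] ∈ ℝ^{2n×2n}. Then Z is positive semidefinite of rank 1 if and only if Λ(Z) is positive semidefinite of rank 2. Equivalently, Z = z z^H for some nonzero z ∈ ℂⁿ if and only if Λ(Z) = x xᵀ + y yᵀ for some nonzero real vectors x, y ∈ ℝ^{2n} spanning a 2-dimensional space. -/
open scoped ComplexOrder

noncomputable section

/-- The ring homomorphism `Λ` sending a complex matrix `Z` to the real matrix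
`[[Re Z, −Im Z],[Im Z, Re Z]]`. -/
def Lam {n : ℕ} (Z : Matrix (Fin n) (Fin n) ℂ) :
    Matrix (Fin n ⊕ Fin n) (Fin n ⊕ Fin n) ℝ :=
  Matrix.fromBlocks (Z.map Complex.re) (-(Z.map Complex.im))
    (Z.map Complex.im) (Z.map Complex.re)

def eLam (n : ℕ) : (Fin n → ℂ) ≃ₗ[ℝ] (Fin n ⊕ Fin n → ℝ) where
  toFun v := Sum.elim (fun i => (v i).re) (fun i => (v i).im)
  invFun w := fun i => ⟨w (Sum.inl i), w (Sum.inr i)⟩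
  map_add' u v := by ext i; cases i <;> simp
  map_smul' c v := by ext i; cases i <;> simp
  left_inv v := by ext i; simp
  right_inv w := by ext i; cases i <;> simp

theorem eLam_mulVec {n : ℕ} (Z : Matrix (Fin n) (Fin n) ℂ) (v : Fin n → ℂ) :
    (Lam Z).mulVec (eLam n v) = eLam n (Z.mulVec v) := by
  ext i
  cases i <;>
    simp [Lam, eLam, Matrix.mulVec, dotProduct, Fintype.sum_sum_type, Complex.re_sum,
      Complex.im_sum, Finset.sum_add_distrib, sub_eq_add_neg, add_comm]

theorem eLam_dot {n : ℕ} (u v : Fin n → ℂ) :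
    dotProduct (eLam n u) (eLam n v) = (dotProduct (star u) v).re := by
  simp [eLam, dotProduct, Fintype.sum_sum_type, Complex.re_sum, Finset.sum_add_distrib]

theorem Lam_rank {n : ℕ} (Z : Matrix (Fin n) (Fin n) ℂ) : (Lam Z).rank = 2 * Z.rank := by
  unfold Matrix.rank
  rw [← finrank_real_of_complex]
  have h : LinearMap.range (Lam Z).mulVecLin =
      ((LinearMap.range Z.mulVecLin).restrictScalars ℝ).map (eLam n).toLinearMap := by
    ext w
    simp only [LinearMap.mem_range, Matrix.mulVecLin_apply, Submodule.mem_map,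
      Submodule.restrictScalars_mem]
    constructor
    · rintro ⟨w, rfl⟩
      obtain ⟨v, rfl⟩ := (eLam n).surjective w
      exact ⟨_, ⟨v, rfl⟩, (eLam_mulVec Z v).symm⟩
    · rintro ⟨_, ⟨v, rfl⟩, rfl⟩
      exact ⟨eLam n v, eLam_mulVec Z v⟩
  rw [h]
  exact LinearEquiv.finrank_map_eq (eLam n) _

theorem Lam_herm {n : ℕ} (Z : Matrix (Fin n) (Fin n) ℂ) (hZ : Z.IsHermitian) :
    (Lam Z).IsHermitian := by
  have h : ∀ i j, star (Z j i) = Z i j := fun i j => hZ.apply i j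
  have hr : ∀ i j, (Z j i).re = (Z i j).re := fun i j => by rw [← h i j]; simp
  have hi : ∀ i j, -(Z j i).im = (Z i j).im := fun i j => by rw [← h i j]; simp
  ext i j
  rcases i with i | i <;> rcases j with j | j <;> simp [Lam, hr i j, ← hi i j]

theorem Lam_psd {n : ℕ} (Z : Matrix (Fin n) (Fin n) ℂ) (hZ : Z.IsHermitian) :
    Z.PosSemidef ↔ (Lam Z).PosSemidef := by
  rw [Matrix.posSemidef_iff_dotProduct_mulVec, Matrix.posSemidef_iff_dotProduct_mulVec]
  refine and_congr ⟨fun _ => Lam_herm Z hZ, fun _ => hZ⟩ ?_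
  rw [(eLam n).surjective.forall]
  refine forall_congr' fun v => ?_
  rw [eLam_mulVec, star_trivial (eLam n v), eLam_dot, Complex.le_def]
  have := hZ.im_star_dotProduct_mulVec_self v
  simp only [RCLike.im_to_complex] at this
  simp [this]

/-- A Hermitian matrix `Z` is positive semidefinite of rank 1 if and only if
`Λ(Z)` is positive semidefinite of rank 2. -/
theorem stmt0 {n : ℕ} (Z : Matrix (Fin n) (Fin n) ℂ) (hZ : Z.IsHermitian) :
    (Z.PosSemidef ∧ Z.rank = 1) ↔ ((Lam Z).PosSemidef ∧ (Lam Z).rank = 2) := by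
  rw [Lam_psd Z hZ, Lam_rank]
  exact and_congr_right fun _ => by omega
end
end

section
/- (D'Angelo–Putinar Positivstellensatz.) Assume that two of the constraint polynomials g_i are s and −s, where s(z) := 1 − |z₁|² − ⋯ − |zₙ|², so that K satisfies the sphere constraint |z₁|²+⋯+|zₙ|² = 1. If f(z) > 0 for all z ∈ K, then there exist σ₀, σ₁, …, σ_m ∈ Σ[z] such that f(z) = Σ_{i=0}^m σ_i(z) g_i(z) for all z ∈ ℂⁿ. -/
open scoped BigOperators ComplexOrder
open Classical Filter

noncomputable section

/-- Multi-indices in `ℕⁿ`. -/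
abbrev MIdx (n : ℕ) := Fin n → ℕ

/-- `|α| = α₁ + ⋯ + αₙ`. -/
def mdeg {n : ℕ} (α : MIdx n) : ℕ := ∑ i, α i

/-- The monomial `z^α := z₁^{α₁} ⋯ zₙ^{αₙ}`. -/
def mpow {n : ℕ} (z : Fin n → ℂ) (α : MIdx n) : ℂ := ∏ i, z i ^ α i

/-- Evaluation of the coefficient array `c` as the (real part of the) complex
polynomial `z ↦ Σ_{α,β} c_{α,β} z̄^α z^β`. -/
def peval {n : ℕ} (c : MIdx n → MIdx n → ℂ) (z : Fin n → ℂ) : ℝ :=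
  (∑ᶠ α : MIdx n, ∑ᶠ β : MIdx n, c α β * (starRingEnd ℂ) (mpow z α) * mpow z β).re

/-- Evaluation of a holomorphic polynomial with coefficients `p`. -/
def hpeval {n : ℕ} (p : MIdx n → ℂ) (z : Fin n → ℂ) : ℂ :=
  ∑ᶠ α : MIdx n, p α * mpow z α

/-- `σ ∈ Σ_d[z]`: `σ` is a finite sum of squared moduli of holomorphic polynomials
of degree at most `d`. -/
def IsSOSUpTo {n : ℕ} (d : ℕ) (σ : (Fin n → ℂ) → ℝ) : Prop :=
  ∃ (r : ℕ) (p : Fin r → MIdx n → ℂ),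
    (∀ j α, p j α ≠ 0 → mdeg α ≤ d) ∧
    ∀ z, σ z = ∑ j, Complex.normSq (hpeval (p j) z)

/-- `σ ∈ Σ[z]`. -/
def IsSOS {n : ℕ} (σ : (Fin n → ℂ) → ℝ) : Prop := ∃ d, IsSOSUpTo d σ

/-- Hermitian coefficient array of degree at most `l` (real-valued complex polynomial). -/
def IsPolyDeg {n : ℕ} (l : ℕ) (c : MIdx n → MIdx n → ℂ) : Prop :=
  (∀ α β, c α β ≠ 0 → mdeg α ≤ l ∧ mdeg β ≤ l) ∧
  (∀ α β, (starRingEnd ℂ) (c α β) = c β α)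

/-- `c` has a nonzero coefficient `c_{α,β}` with `|α| = l` (degree exactly `l`). -/
def HasTopDeg {n : ℕ} (l : ℕ) (c : MIdx n → MIdx n → ℂ) : Prop :=
  ∃ α β, mdeg α = l ∧ mdeg β ≤ l ∧ c α β ≠ 0

/-- Multi-indices of degree at most `e`, indexing moment matrices. -/
def Idx (n e : ℕ) := {α : MIdx n // mdeg α ≤ e}

noncomputable instance {n e : ℕ} : Fintype (Idx n e) :=
  Fintype.ofInjective
    (fun a : Idx n e => (fun i =>
      (⟨a.1 i, Nat.lt_succ_of_le (le_trans
        (Finset.single_le_sum (f := a.1) (fun j _ => Nat.zero_le _) (Finset.mem_univ i))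
        a.2)⟩ : Fin (e + 1)) : Fin n → Fin (e + 1)))
    (fun a b h => Subtype.ext (funext fun i => congrArg Fin.val (congrFun h i)))

/-- Entry `(α,β)` of the localizing matrix `M(φ y)`:
`Σ_{γ,δ} φ_{γ,δ} y_{α+γ, β+δ}`. -/
def momEntry {n : ℕ} (φ y : MIdx n → MIdx n → ℂ) (α β : MIdx n) : ℂ :=
  ∑ᶠ γ : MIdx n, ∑ᶠ δ : MIdx n, φ γ δ * y (α + γ) (β + δ)

/-- The localizing matrix `M_e(φ y)` indexed by multi-indices of degree at most `e`. -/
def momMatrix (n e : ℕ) (φ y : MIdx n → MIdx n → ℂ) :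
    Matrix (Idx n e) (Idx n e) ℂ :=
  Matrix.of fun a b => momEntry φ y a.1 b.1

/-- The moment matrix `M_e(y)` indexed by multi-indices of degree at most `e`. -/
def momMatrixId (n e : ℕ) (y : MIdx n → MIdx n → ℂ) :
    Matrix (Idx n e) (Idx n e) ℂ :=
  Matrix.of fun a b => y a.1 b.1

/-- The Riesz functional `L_y(c) = Σ_{α,β} c_{α,β} y_{α,β}` (real part). -/
def Ly {n : ℕ} (c y : MIdx n → MIdx n → ℂ) : ℝ :=
  (∑ᶠ α : MIdx n, ∑ᶠ β : MIdx n, c α β * y α β).re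

/-- `y ∈ H_d`: hermitian array truncated at degree `d`. -/
def HermArr (n d : ℕ) (y : MIdx n → MIdx n → ℂ) : Prop :=
  ∀ α β : MIdx n, mdeg α ≤ d → mdeg β ≤ d → (starRingEnd ℂ) (y α β) = y β α

/-- The feasible set `K = {z : g_i(z) ≥ 0, i = 1,…,m}`. -/
def Kset {n m : ℕ} (g : Fin m → MIdx n → MIdx n → ℂ) : Set (Fin n → ℂ) :=
  {z | ∀ i, 0 ≤ peval (g i) z}

/-- Coefficients of the polynomial `s(z) = R² − |z₁|² − ⋯ − |zₙ|²`. -/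
def spherePoly (n : ℕ) (R : ℝ) : MIdx n → MIdx n → ℂ := fun α β =>
  if α = 0 ∧ β = 0 then ((R ^ 2 : ℝ) : ℂ)
  else if ∃ i : Fin n, α = Pi.single i 1 ∧ β = Pi.single i 1 then -1 else 0

/-- Feasibility for the complex moment relaxation of order `d`. -/
def MomFeas (n m d : ℕ) (g : Fin m → MIdx n → MIdx n → ℂ) (kk : Fin m → ℕ)
    (y : MIdx n → MIdx n → ℂ) : Prop :=
  HermArr n d y ∧ y 0 0 = 1 ∧ (momMatrixId n d y).PosSemidef ∧
    ∀ i, (momMatrix n (d - kk i) (g i) y).PosSemidef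

/-- `ρ_d`: optimal value of the complex moment relaxation of order `d`. -/
def rhoMom (n m d : ℕ) (f : MIdx n → MIdx n → ℂ) (g : Fin m → MIdx n → MIdx n → ℂ)
    (kk : Fin m → ℕ) : EReal :=
  sInf {x : EReal | ∃ y, MomFeas n m d g kk y ∧ x = ((Ly f y : ℝ) : EReal)}

/-- A degree-`d` sum-of-squares certificate `f − λ = Σ_{i=0}^m σ_i g_i`. -/
def SOSCert (n m d : ℕ) (f : MIdx n → MIdx n → ℂ) (g : Fin m → MIdx n → MIdx n → ℂ)
    (kk : Fin m → ℕ) (lam : ℝ) : Prop :=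
  ∃ (σ0 : (Fin n → ℂ) → ℝ) (σ : Fin m → (Fin n → ℂ) → ℝ),
    IsSOSUpTo d σ0 ∧ (∀ i, IsSOSUpTo (d - kk i) (σ i)) ∧
    ∀ z, peval f z - lam = σ0 z + ∑ i, σ i z * peval (g i) z

/-- `ρ_d*`: optimal value of the complex sum-of-squares relaxation of order `d`. -/
def rhoSOS (n m d : ℕ) (f : MIdx n → MIdx n → ℂ) (g : Fin m → MIdx n → MIdx n → ℂ)
    (kk : Fin m → ℕ) : EReal :=
  sSup {x : EReal | ∃ lam : ℝ, SOSCert n m d f g kk lam ∧ x = ((lam : ℝ) : EReal)}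

/-- `f^opt = inf_K f` as an extended real number. -/
def fOpt (n m : ℕ) (f : MIdx n → MIdx n → ℂ) (g : Fin m → MIdx n → MIdx n → ℂ) : EReal :=
  sInf {x : EReal | ∃ z ∈ Kset g, x = ((peval f z : ℝ) : EReal)}

/-- Sphere assumption: two of the constraint polynomials are `s` and `−s` where
`s(z) = R² − |z₁|² − ⋯ − |zₙ|²`. -/
def SphereAssumption (n m : ℕ) (g : Fin m → MIdx n → MIdx n → ℂ) (R : ℝ) : Prop :=
  0 < R ∧ ∃ i₁ i₂ : Fin m, i₁ ≠ i₂ ∧ g i₁ = spherePoly n R ∧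
    (∀ α β, g i₂ α β = -(spherePoly n R α β))

theorem aux_arch {A : Type*} [CommRing A] [Algebra ℝ A] (X : Set A)
    (hX : Algebra.adjoin ℝ X = ⊤) (M : Set A)
    (hadd : ∀ a ∈ M, ∀ b ∈ M, a + b ∈ M) (hsm : ∀ r : ℝ, 0 ≤ r → ∀ a ∈ M, r • a ∈ M)
    (h1 : (1 : A) ∈ M)
    (hXM : ∀ x ∈ X, ∀ a ∈ M, (1 + x) * a ∈ M ∧ (1 - x) * a ∈ M) (a : A) :
    ∃ N : ℝ, N • (1 : A) - a ∈ M := by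
  have key : ∀ a : A, ∃ N : ℝ, 0 ≤ N ∧ (∀ b ∈ M, (N • (1 : A) - a) * b ∈ M) ∧
      (∀ b ∈ M, (N • (1 : A) + a) * b ∈ M) := by
    intro a
    have ha : a ∈ Algebra.adjoin ℝ X := by rw [hX]; trivial
    induction ha using Algebra.adjoin_induction with
    | mem x hx =>
      refine ⟨1, zero_le_one, fun b hb => ?_, fun b hb => ?_⟩
      · simpa using (hXM x hx b hb).2
      · simpa using (hXM x hx b hb).1
    | algebraMap r =>
      refine ⟨|r|, abs_nonneg r, fun b hb => ?_, fun b hb => ?_⟩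
      · have := hsm (|r| - r) (sub_nonneg.2 (le_abs_self r)) b hb
        rwa [Algebra.algebraMap_eq_smul_one, ← sub_smul, smul_mul_assoc, one_mul]
      · have := hsm (|r| + r) (by linarith [neg_abs_le r]) b hb
        rwa [Algebra.algebraMap_eq_smul_one, ← add_smul, smul_mul_assoc, one_mul]
    | add x y _ _ hx hy =>
      obtain ⟨N, hN, hx1, hx2⟩ := hx
      obtain ⟨N', hN', hy1, hy2⟩ := hy
      refine ⟨N + N', add_nonneg hN hN', fun b hb => ?_, fun b hb => ?_⟩
      · have := hadd _ (hx1 b hb) _ (hy1 b hb)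
        convert this using 1
        rw [add_smul]; ring
      · have := hadd _ (hx2 b hb) _ (hy2 b hb)
        convert this using 1
        rw [add_smul]; ring
    | mul x y _ _ hx hy =>
      obtain ⟨N, hN, hx1, hx2⟩ := hx
      obtain ⟨N', hN', hy1, hy2⟩ := hy
      refine ⟨N * N', mul_nonneg hN hN', fun b hb => ?_, fun b hb => ?_⟩
      · have := hsm (1/2) (by norm_num) _
          (hadd _ (hx1 _ (hy2 b hb)) _ (hx2 _ (hy1 b hb)))
        convert this using 1
        simp only [Algebra.smul_def, mul_one, map_mul]
        have h2 : algebraMap ℝ A (1/2) * 2 = 1 := by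
          rw [← map_ofNat (algebraMap ℝ A) 2, ← map_mul]; norm_num
        linear_combination (-(algebraMap ℝ A N * algebraMap ℝ A N' - x * y) * b) * h2
      · have := hsm (1/2) (by norm_num) _
          (hadd _ (hx1 _ (hy1 b hb)) _ (hx2 _ (hy2 b hb)))
        convert this using 1
        simp only [Algebra.smul_def, mul_one, map_mul]
        have h2 : algebraMap ℝ A (1/2) * 2 = 1 := by
          rw [← map_ofNat (algebraMap ℝ A) 2, ← map_mul]; norm_num
        linear_combination (-(algebraMap ℝ A N * algebraMap ℝ A N' + x * y) * b) * h2
  obtain ⟨N, _, h, _⟩ := key a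
  exact ⟨N, by simpa using h 1 h1⟩

theorem aux_sep {A : Type*} [CommRing A] [Algebra ℝ A] (M : Set A)
    (hadd : ∀ a ∈ M, ∀ b ∈ M, a + b ∈ M) (hsm : ∀ r : ℝ, 0 ≤ r → ∀ a ∈ M, r • a ∈ M)
    (h1 : (1 : A) ∈ M)
    (arch : ∀ a : A, ∃ N : ℝ, N • (1 : A) - a ∈ M) (f : A) (hf : f ∉ M) :
    ∃ L : A →ₗ[ℝ] ℝ, L 1 = 1 ∧ L f ≤ 0 ∧ ∀ a ∈ M, 0 ≤ L a := by
  have h0 : (0 : A) ∈ M := by simpa using hsm 0 le_rfl 1 h1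
  have hne : (1 : A) ≠ 0 := by
    intro h
    apply hf
    have : f = 0 := by rw [← mul_one f, h, mul_zero]
    rwa [this]
  let C : PointedCone ℝ A :=
    { carrier := {a | ∃ m ∈ M, ∃ t : ℝ, 0 ≤ t ∧ a = m - t • f}
      add_mem' := by
        rintro a b ⟨m, hm, t, ht, rfl⟩ ⟨m', hm', t', ht', rfl⟩
        exact ⟨m + m', hadd _ hm _ hm', t + t', add_nonneg ht ht', by rw [add_smul]; abel⟩
      zero_mem' := ⟨0, h0, 0, le_rfl, by simp⟩
      smul_mem' := by
        rintro ⟨c, hc⟩ a ⟨m, hm, t, ht, rfl⟩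
        refine ⟨c • m, hsm c hc m hm, c * t, mul_nonneg hc ht, ?_⟩
        change c • (m - t • f) = _
        rw [smul_sub, smul_smul] }
  have hCM : ∀ m ∈ M, m ∈ C := fun m hm => ⟨m, hm, 0, le_rfl, by simp⟩
  obtain ⟨L, hL1, hL2⟩ := riesz_extension C (LinearPMap.mkSpanSingleton (K := ℝ) (1 : A) (1 : ℝ) hne)
    (by
      rintro ⟨x, hx⟩ hxC
      obtain ⟨c, rfl⟩ := Submodule.mem_span_singleton.1 hx
      have hval : (LinearPMap.mkSpanSingleton (K := ℝ) (1 : A) (1 : ℝ) hne) ⟨c • (1 : A), hx⟩ = c • (1 : ℝ) :=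
        LinearPMap.mkSpanSingleton'_apply _ _ _ _ _
      rw [hval]
      obtain ⟨m, hm, t, ht, h⟩ := hxC
      simp only [smul_eq_mul, mul_one]
      by_contra hc
      push Not at hc
      have htf : t • f = m + (-c) • (1 : A) := by
        rw [neg_smul]
        change c • (1 : A) = m - t • f at h
        rw [h]; abel
      have htM : t • f ∈ M := by
        rw [htf]; exact hadd _ hm _ (hsm _ (by linarith) _ h1)
      rcases ht.eq_or_lt with rfl | ht
      · have hm1 : (-1 : A) ∈ M := by
          have := hsm (-c)⁻¹ (inv_nonneg.2 (by linarith)) m hm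
          have hm' : m = (-c) • (-1 : A) := by
            rw [zero_smul] at htf
            rw [smul_neg, eq_neg_iff_add_eq_zero]; exact htf.symm
          rwa [hm', smul_smul, inv_mul_cancel₀ (by linarith), one_smul] at this
        obtain ⟨N, hN⟩ := arch (-f)
        apply hf
        have := hadd _ hN _ (hsm |N| (abs_nonneg _) _ hm1)
        have := hadd _ this _ (hsm (|N| - N) (sub_nonneg.2 (le_abs_self _)) _ h1)
        convert this using 1
        rw [sub_smul, smul_neg]; abel
      · apply hf
        have := hsm t⁻¹ (inv_nonneg.2 ht.le) _ htM
        rwa [smul_smul, inv_mul_cancel₀ ht.ne', one_smul] at this)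
    (by
      intro y
      obtain ⟨N, hN⟩ := arch (-y)
      exact ⟨⟨N • 1, Submodule.smul_mem _ _ (Submodule.mem_span_singleton_self _)⟩,
        hCM _ (by simpa using hN)⟩)
  refine ⟨L, ?_, ?_, fun a ha => hL2 a (hCM a ha)⟩
  · have := hL1 ⟨1, Submodule.mem_span_singleton_self _⟩
    rw [this]
    exact LinearPMap.mkSpanSingleton_apply ℝ ℝ hne (1:ℝ)
  · have : -f ∈ C := ⟨0, h0, 1, zero_le_one, by simp⟩
    have := hL2 _ this
    rw [map_neg] at this
    linarith

theorem aux_abs {A : Type*} [CommRing A] [Algebra ℝ A] (X : Set A)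
    (hX : Algebra.adjoin ℝ X = ⊤) (M : Set A)
    (hadd : ∀ a ∈ M, ∀ b ∈ M, a + b ∈ M) (hsm : ∀ r : ℝ, 0 ≤ r → ∀ a ∈ M, r • a ∈ M)
    (h1 : (1 : A) ∈ M)
    (hXM : ∀ x ∈ X, ∀ a ∈ M, (1 + x) * a ∈ M ∧ (1 - x) * a ∈ M) (f : A)
    (hf : ∀ φ : A →ₐ[ℝ] ℝ, (∀ a ∈ M, 0 ≤ φ a) → 0 < φ f) : f ∈ M := by
  have arch := aux_arch X hX M hadd hsm h1 hXM
  by_contra hfM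
  obtain ⟨L₀, hL1, hLf, hLM⟩ := aux_sep M hadd hsm h1 arch f hfM
  let S : Set (A → ℝ) := {L | (∀ a b, L (a + b) = L a + L b) ∧ (∀ (r : ℝ) a, L (r • a) = r * L a) ∧
    L 1 = 1 ∧ ∀ a ∈ M, 0 ≤ L a}
  have hL₀ : (L₀ : A → ℝ) ∈ S := ⟨map_add L₀, fun r a => by simp, hL1, hLM⟩
  have hclosed : IsClosed S := by
    have e : S = (⋂ a, ⋂ b, {L | L (a + b) = L a + L b}) ∩ ((⋂ r : ℝ, ⋂ a, {L | L (r • a) = r * L a}) ∩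
        ({L | L 1 = 1} ∩ ⋂ a ∈ M, {L | 0 ≤ L a})) := by
      ext L; simp [S]
    rw [e]
    refine IsClosed.inter ?_ (IsClosed.inter ?_ (IsClosed.inter ?_ ?_))
    · exact isClosed_iInter fun a => isClosed_iInter fun b => isClosed_eq (by fun_prop) (by fun_prop)
    · exact isClosed_iInter fun a => isClosed_iInter fun b => isClosed_eq (by fun_prop) (by fun_prop)
    · exact isClosed_eq (by fun_prop) (by fun_prop)
    · exact isClosed_iInter fun a => isClosed_iInter fun b => isClosed_le (by fun_prop) (by fun_prop)
  choose N hN using arch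
  have hneg : ∀ L ∈ S, ∀ a, L (-a) = - L a := by
    intro L hL a
    have := hL.2.1 (-1) a
    simpa using this
  have hle : ∀ L ∈ S, ∀ a, L a ≤ N a := by
    intro L hL a
    have h := hL.2.2.2 _ (hN a)
    rw [sub_eq_add_neg, hL.1, hL.2.1, hL.2.2.1, hneg L hL] at h
    linarith
  have hcomp : IsCompact S := by
    refine IsCompact.of_isClosed_subset
      (isCompact_univ_pi (fun a : A => isCompact_Icc (a := -N (-a)) (b := N a))) hclosed ?_
    intro L hL a _
    refine ⟨?_, hle L hL a⟩
    have := hle L hL (-a)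
    rw [hneg L hL] at this
    linarith
  obtain ⟨L₁, hL₁, hmin⟩ := hcomp.exists_isMinOn ⟨_, hL₀⟩
    (f := fun L : A → ℝ => L f) (by fun_prop)
  let S' : Set (A → ℝ) := S ∩ {L | L f ≤ L₁ f}
  have hcomp' : IsCompact S' :=
    hcomp.inter_right (isClosed_le (by fun_prop) (by fun_prop))
  obtain ⟨L, hL⟩ := hcomp'.extremePoints_nonempty ⟨L₁, hL₁, le_refl (L₁ f)⟩
  rw [mem_extremePoints_iff_left] at hL
  obtain ⟨⟨hLS, hLf'⟩, hext⟩ := hL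
  have hmin' : ∀ L' ∈ S, L₁ f ≤ L' f := fun L' hL' => hmin hL'
  have hLf0 : L f ≤ 0 := le_trans hLf' ((hmin' _ hL₀).trans hLf)
  -- multiplicativity for elements t with t, 1 - t multiplying M into itself
  have hzero : ∀ t : A, (∀ a ∈ M, t * a ∈ M) → L t = 0 → ∀ a, L (t * a) = 0 := by
    intro t ht h0 a
    have hb : ∀ a, L (t * a) ≤ 0 := by
      intro a
      have h := hLS.2.2.2 _ (ht _ (hN a))
      rw [mul_sub, mul_smul_comm, mul_one, sub_eq_add_neg, hLS.1, hLS.2.1, hneg L hLS, h0] at h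
      linarith
    have h2 := hb (-a)
    rw [mul_neg, hneg L hLS] at h2
    linarith [hb a]
  have hscale : ∀ t : A, (∀ a ∈ M, t * a ∈ M) → 0 < L t →
      (fun a => (L t)⁻¹ * L (t * a)) ∈ S := by
    intro t ht hp
    refine ⟨fun a b => ?_, fun r a => ?_, ?_, fun a ha => ?_⟩
    · simp only [mul_add, hLS.1]
    · simp only [mul_smul_comm, hLS.2.1]; ring
    · simp only [mul_one]; exact inv_mul_cancel₀ hp.ne'
    · exact mul_nonneg (inv_nonneg.2 hp.le) (hLS.2.2.2 _ (ht a ha))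
  have hmult : ∀ t : A, (∀ a ∈ M, t * a ∈ M) → (∀ a ∈ M, (1 - t) * a ∈ M) →
      ∀ a, L (t * a) = L t * L a := by
    intro t ht ht' a
    have e : ∀ a, L a = L (t * a) + L ((1 - t) * a) := by
      intro a; rw [← hLS.1]; congr 1; ring
    have e1 : L t + L (1 - t) = 1 := by rw [← hLS.1, ← hLS.2.2.1]; congr 1; ring
    have n1 : 0 ≤ L t := by have := hLS.2.2.2 _ (ht 1 h1); rwa [mul_one] at this
    have n2 : 0 ≤ L (1 - t) := by have := hLS.2.2.2 _ (ht' 1 h1); rwa [mul_one] at this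
    rcases n1.eq_or_lt with z1 | p1
    · rw [hzero t ht z1.symm, ← z1, zero_mul]
    rcases n2.eq_or_lt with z2 | p2
    · have := hzero (1 - t) ht' z2.symm a
      have e2 := e a
      have : L t = 1 := by linarith
      rw [this]; linarith
    have m1 := hscale t ht p1
    have m2 := hscale (1 - t) ht' p2
    have q1 := hmin' _ m1
    have q2 := hmin' _ m2
    have c1 : L t * ((L t)⁻¹ * L (t * f)) = L (t * f) := by field_simp
    have c2 : L (1 - t) * ((L (1 - t))⁻¹ * L ((1 - t) * f)) = L ((1 - t) * f) := by field_simp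
    have ef := e f
    have hLf'' : L f ≤ L₁ f := hLf'
    have r1 : (L t)⁻¹ * L (t * f) ≤ L₁ f := by
      by_contra hcon
      push Not at hcon
      nlinarith
    have r2 : (L (1 - t))⁻¹ * L ((1 - t) * f) ≤ L₁ f := by
      by_contra hcon
      push Not at hcon
      nlinarith
    have := hext _ ⟨m1, r1⟩ _ ⟨m2, r2⟩ ⟨L t, L (1 - t), p1, p2, e1, by
      funext b
      have d1 : L t * ((L t)⁻¹ * L (t * b)) = L (t * b) := by field_simp
      have d2 : L (1 - t) * ((L (1 - t))⁻¹ * L ((1 - t) * b)) = L ((1 - t) * b) := by field_simp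
      simp only [Pi.add_apply, Pi.smul_apply, smul_eq_mul]
      rw [d1, d2, ← e]⟩
    have h9 : (L t)⁻¹ * L (t * a) = L a := congrFun this a
    rw [← h9]; field_simp
  have hmul : ∀ x a, L (x * a) = L x * L a := by
    intro x
    have hx : x ∈ Algebra.adjoin ℝ X := by rw [hX]; trivial
    induction hx using Algebra.adjoin_induction with
    | mem x hx =>
      intro a
      have h2 : algebraMap ℝ A (1/2) * 2 = 1 := by
        rw [← map_ofNat (algebraMap ℝ A) 2, ← map_mul]; norm_num
      have := hmult ((1/2 : ℝ) • (1 + x))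
        (fun a ha => by
          rw [smul_mul_assoc]; exact hsm _ (by norm_num) _ (hXM x hx a ha).1)
        (fun a ha => by
          have := hsm (1/2) (by norm_num) _ (hXM x hx a ha).2
          convert this using 1
          simp only [Algebra.smul_def]
          linear_combination (-a) * h2) a
      rw [smul_mul_assoc, add_mul, one_mul, hLS.2.1, hLS.2.1, hLS.1, hLS.1, hLS.2.2.1] at this
      linarith
    | algebraMap r =>
      intro a
      rw [Algebra.algebraMap_eq_smul_one, smul_mul_assoc, one_mul, hLS.2.1, hLS.2.1, hLS.2.2.1, mul_one]
    | add x y _ _ hx hy => intro a; rw [add_mul, hLS.1, hLS.1, hx, hy, add_mul]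
    | mul x y _ _ hx hy => intro a; rw [mul_assoc, hx, hy, hx, mul_assoc]
  let φ : A →ₐ[ℝ] ℝ := AlgHom.ofLinearMap
    { toFun := L, map_add' := hLS.1, map_smul' := fun r a => by simp [hLS.2.1] }
    hLS.2.2.1 hmul
  have := hf φ hLS.2.2.2
  exact absurd (show 0 < L f from this) (not_lt.2 hLf0)

/-- Evaluation of real polynomials in the real and imaginary parts. -/
def aux_ev (n : ℕ) : MvPolynomial (Fin n ⊕ Fin n) ℝ →ₐ[ℝ] ((Fin n → ℂ) → ℝ) :=
  MvPolynomial.aeval (Sum.elim (fun j z => (z j).re) (fun j z => (z j).im))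

theorem aux_ev_inl (n : ℕ) (j : Fin n) (z : Fin n → ℂ) :
    aux_ev n (MvPolynomial.X (Sum.inl j)) z = (z j).re := by simp [aux_ev]

theorem aux_ev_inr (n : ℕ) (j : Fin n) (z : Fin n → ℂ) :
    aux_ev n (MvPolynomial.X (Sum.inr j)) z = (z j).im := by simp [aux_ev]

theorem aux_ev_C (n : ℕ) (r : ℝ) (z : Fin n → ℂ) :
    aux_ev n (MvPolynomial.C r) z = r := by simp [aux_ev]

/-- Functions with polynomial real and imaginary parts. -/
def auxPF (n : ℕ) : Subsemiring ((Fin n → ℂ) → ℂ) where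
  carrier := {h | ∃ P Q, ∀ z, h z = (aux_ev n P z : ℂ) + (aux_ev n Q z : ℂ) * Complex.I}
  zero_mem' := ⟨0, 0, fun z => by simp⟩
  one_mem' := ⟨1, 0, fun z => by simp⟩
  add_mem' := by
    rintro a b ⟨P, Q, h⟩ ⟨P', Q', h'⟩
    refine ⟨P + P', Q + Q', fun z => ?_⟩
    simp only [Pi.add_apply, h, h', map_add, Complex.ofReal_add]; ring
  mul_mem' := by
    rintro a b ⟨P, Q, h⟩ ⟨P', Q', h'⟩
    refine ⟨P * P' - Q * Q', P * Q' + Q * P', fun z => ?_⟩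
    simp only [Pi.add_apply, Pi.sub_apply, Pi.mul_apply, h, h', map_add, map_sub, map_mul,
      Complex.ofReal_add, Complex.ofReal_sub, Complex.ofReal_mul]
    linear_combination ((aux_ev n Q z : ℂ) * (aux_ev n Q' z : ℂ)) * Complex.I_mul_I

theorem auxPF_const (n : ℕ) (c : ℂ) : (fun _ => c) ∈ auxPF n :=
  ⟨MvPolynomial.C c.re, MvPolynomial.C c.im, fun z => by simp [aux_ev_C]⟩

theorem auxPF_coord (n : ℕ) (j : Fin n) : (fun z => z j) ∈ auxPF n :=
  ⟨MvPolynomial.X (Sum.inl j), MvPolynomial.X (Sum.inr j), fun z => by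
    simp [aux_ev_inl, aux_ev_inr]⟩

theorem auxPF_conj (n : ℕ) (h : (Fin n → ℂ) → ℂ) (hh : h ∈ auxPF n) :
    (fun z => (starRingEnd ℂ) (h z)) ∈ auxPF n := by
  obtain ⟨P, Q, h'⟩ := hh
  exact ⟨P, -Q, fun z => by simp [h']⟩

theorem auxPF_mpow (n : ℕ) (α : MIdx n) : (fun z => mpow z α) ∈ auxPF n := by
  have : (fun z => mpow z α) = ∏ i, (fun z : Fin n → ℂ => z i) ^ α i := by
    funext z; simp [mpow]
  rw [this]
  exact prod_mem fun i _ => pow_mem (auxPF_coord n i) _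

theorem aux_finite (n l : ℕ) : {α : MIdx n | mdeg α ≤ l}.Finite := by
  refine Set.Finite.subset (Set.finite_Iic (fun _ : Fin n => l)) ?_
  intro α hα i
  exact le_trans (Finset.single_le_sum (f := α) (fun j _ => Nat.zero_le _) (Finset.mem_univ i)) hα

theorem aux_peval {n : ℕ} (c : MIdx n → MIdx n → ℂ) (D : Finset (MIdx n))
    (hD : ∀ α β, c α β ≠ 0 → α ∈ D ∧ β ∈ D) (z : Fin n → ℂ) :
    peval c z = (∑ α ∈ D, ∑ β ∈ D, c α β * (starRingEnd ℂ) (mpow z α) * mpow z β).re := by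
  unfold peval
  congr 1
  have hin : ∀ α, ∑ᶠ β : MIdx n, c α β * (starRingEnd ℂ) (mpow z α) * mpow z β =
      ∑ β ∈ D, c α β * (starRingEnd ℂ) (mpow z α) * mpow z β := by
    intro α
    apply finsum_eq_sum_of_support_subset
    intro β hβ
    refine (hD α β ?_).2
    intro h0
    simp [h0] at hβ
  simp_rw [hin]
  apply finsum_eq_sum_of_support_subset
  intro α hα
  by_contra hcon
  apply hα
  apply Finset.sum_eq_zero
  intro β _
  have : c α β = 0 := by
    by_contra h
    exact hcon (hD α β h).1
  simp [this]

theorem aux_poly {n l : ℕ} (c : MIdx n → MIdx n → ℂ) (hc : IsPolyDeg l c) :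
    ∃ F, ∀ z, aux_ev n F z = peval c z := by
  have h : (fun z => ∑ α ∈ (aux_finite n l).toFinset, ∑ β ∈ (aux_finite n l).toFinset,
      c α β * (starRingEnd ℂ) (mpow z α) * mpow z β) ∈ auxPF n := by
    have : (fun z => ∑ α ∈ (aux_finite n l).toFinset, ∑ β ∈ (aux_finite n l).toFinset,
      c α β * (starRingEnd ℂ) (mpow z α) * mpow z β) =
      ∑ α ∈ (aux_finite n l).toFinset, ∑ β ∈ (aux_finite n l).toFinset,
      (fun _ => c α β) * (fun z => (starRingEnd ℂ) (mpow z α)) * (fun z => mpow z β) := by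
      funext z; simp
    rw [this]
    exact sum_mem fun α _ => sum_mem fun β _ => mul_mem (mul_mem (auxPF_const n _)
      (auxPF_conj n _ (auxPF_mpow n α))) (auxPF_mpow n β)
  obtain ⟨P, Q, h⟩ := h
  refine ⟨P, fun z => ?_⟩
  rw [aux_peval c (aux_finite n l).toFinset (fun α β hn => by simpa using hc.1 α β hn) z]
  have := h z
  simp only at this
  rw [this]; simp

theorem aux_mpow_single {n : ℕ} (z : Fin n → ℂ) (i : Fin n) :
    mpow z (Pi.single i 1) = z i := by
  unfold mpow
  rw [Finset.prod_eq_single i]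
  · simp
  · intro j _ hj; simp [Pi.single_eq_of_ne hj]
  · simp

theorem aux_sphere {n : ℕ} (z : Fin n → ℂ) :
    peval (spherePoly n 1) z = 1 - ∑ i, Complex.normSq (z i) := by
  have h0 : (0 : MIdx n) ∈ (aux_finite n 1).toFinset := by simp [mdeg]
  have hs : ∀ i, (Pi.single i 1 : MIdx n) ∈ (aux_finite n 1).toFinset := by
    intro i; simp [mdeg]
  rw [aux_peval (spherePoly n 1) (aux_finite n 1).toFinset]
  · have e : ∀ α β, spherePoly n 1 α β = (if α = 0 then if β = 0 then 1 else 0 else 0) -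
        ∑ i, (if α = Pi.single i 1 then if β = Pi.single i 1 then 1 else 0 else 0) := by
      intro α β
      unfold spherePoly
      by_cases hz : α = 0 ∧ β = 0
      · obtain ⟨rfl, rfl⟩ := hz
        have : ∀ i : Fin n, (0 : MIdx n) ≠ Pi.single i 1 := by
          intro i h
          have := congrFun h i
          simp at this
        simp [this]
      · rw [if_neg hz]
        have : (if α = 0 then if β = 0 then (1:ℂ) else 0 else 0) = 0 := by
          by_cases a : α = 0 <;> by_cases b : β = 0 <;> simp_all
        rw [this]
        by_cases hi : ∃ i : Fin n, α = Pi.single i 1 ∧ β = Pi.single i 1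
        · rw [if_pos hi]
          obtain ⟨i, rfl, rfl⟩ := hi
          rw [Finset.sum_eq_single i]
          · simp
          · intro j _ hj
            rw [if_neg]
            intro h
            have := congrFun h i
            simp [Pi.single_eq_of_ne hj.symm] at this
          · simp
        · rw [if_neg hi, Finset.sum_eq_zero]
          · simp
          · intro i _
            by_cases a : α = Pi.single i 1
            · have b : ¬ β = Pi.single i 1 := fun b => hi ⟨i, a, b⟩
              simp [b]
            · simp [a]
    simp_rw [e, sub_mul, Finset.sum_sub_distrib, Finset.sum_mul]
    have c : ∀ i : Fin n, ∑ α ∈ (aux_finite n 1).toFinset, ∑ β ∈ (aux_finite n 1).toFinset,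
        (if α = Pi.single i 1 then if β = Pi.single i 1 then (1:ℂ) else 0 else 0) *
        (starRingEnd ℂ) (mpow z α) * mpow z β = Complex.normSq (z i) := by
      intro i
      rw [Finset.sum_eq_single (Pi.single i 1), Finset.sum_eq_single (Pi.single i 1)]
      · simp only [if_true, one_mul, aux_mpow_single]
        rw [mul_comm, Complex.mul_conj]
      · intro b _ hb; simp [hb]
      · intro h; exact absurd (hs i) h
      · intro b _ hb; simp [hb]
      · intro h; exact absurd (hs i) h
    have c0 : ∑ α ∈ (aux_finite n 1).toFinset, ∑ β ∈ (aux_finite n 1).toFinset,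
        (if α = 0 then if β = 0 then (1:ℂ) else 0 else 0) *
        (starRingEnd ℂ) (mpow z α) * mpow z β = 1 := by
      rw [Finset.sum_eq_single 0, Finset.sum_eq_single 0]
      · simp [mpow]
      · intro b _ hb; simp [hb]
      · intro h; exact absurd h0 h
      · intro b _ hb; simp [hb]
      · intro h; exact absurd h0 h
    have c1 : ∑ α ∈ (aux_finite n 1).toFinset, ∑ β ∈ (aux_finite n 1).toFinset, ∑ i : Fin n,
        (if α = Pi.single i 1 then if β = Pi.single i 1 then (1:ℂ) else 0 else 0) *
        (starRingEnd ℂ) (mpow z α) * mpow z β = ∑ i, (Complex.normSq (z i) : ℂ) := by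
      rw [← Finset.sum_congr rfl (fun i _ => c i)]
      rw [Finset.sum_comm]
      rw [Finset.sum_congr rfl fun α _ => Finset.sum_comm]
      rw [Finset.sum_comm]
      rw [Finset.sum_congr rfl fun α _ => Finset.sum_comm]
    rw [c0, c1]
    simp [← Complex.ofReal_sum]
  · intro α β h
    unfold spherePoly at h
    split_ifs at h with h1 h2
    · rw [h1.1, h1.2]; exact ⟨h0, h0⟩
    · obtain ⟨i, rfl, rfl⟩ := h2
      exact ⟨hs i, hs i⟩
    · exact absurd rfl h

theorem aux_peval_neg {n : ℕ} (c d : MIdx n → MIdx n → ℂ) (h : ∀ α β, d α β = - c α β)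
    (z : Fin n → ℂ) : peval d z = - peval c z := by
  unfold peval
  simp_rw [h, neg_mul, finsum_neg_distrib]
  simp

/-- Squared moduli of holomorphic polynomials. -/
def auxSq (n : ℕ) : Submonoid ((Fin n → ℂ) → ℝ) where
  carrier := {h | ∃ P : MvPolynomial (Fin n) ℂ, ∀ z, h z = Complex.normSq (MvPolynomial.eval z P)}
  one_mem' := ⟨1, fun z => by simp⟩
  mul_mem' := by
    rintro a b ⟨P, h⟩ ⟨Q, h'⟩
    exact ⟨P * Q, fun z => by simp [h, h']⟩

/-- The semiring of sums of squared moduli. -/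
def auxSig (n : ℕ) : Subsemiring ((Fin n → ℂ) → ℝ) := (auxSq n).subsemiringClosure

theorem auxSig_sq {n : ℕ} (P : MvPolynomial (Fin n) ℂ) :
    (fun z => Complex.normSq (MvPolynomial.eval z P)) ∈ auxSig n := by
  unfold auxSig
  rw [Submonoid.subsemiringClosure_mem]
  exact AddSubmonoid.subset_closure ⟨P, fun z => rfl⟩

theorem auxSig_const {n : ℕ} (r : ℝ) (hr : 0 ≤ r) : (fun _ => r) ∈ auxSig n := by
  have := auxSig_sq (n := n) (MvPolynomial.C (Real.sqrt r : ℂ))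
  simpa [Complex.normSq_ofReal, Real.mul_self_sqrt hr] using this

theorem aux_hpeval {n : ℕ} (P : MvPolynomial (Fin n) ℂ) (z : Fin n → ℂ) :
    hpeval (fun α => MvPolynomial.coeff (Finsupp.equivFunOnFinite.symm α) P) z =
      MvPolynomial.eval z P := by
  unfold hpeval
  rw [MvPolynomial.eval_eq', ← finsum_comp_equiv Finsupp.equivFunOnFinite]
  simp only [Equiv.symm_apply_apply]
  rw [finsum_eq_sum_of_support_subset (s := P.support)]
  · rfl
  · intro d hd
    rw [Finset.mem_coe, MvPolynomial.mem_support_iff]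
    intro h
    simp [h] at hd

theorem aux_isSOS {n : ℕ} (σ : (Fin n → ℂ) → ℝ) (h : σ ∈ auxSig n) : IsSOS σ := by
  unfold auxSig at h
  rw [Submonoid.subsemiringClosure_mem] at h
  induction h using AddSubmonoid.closure_induction with
  | mem σ h =>
    obtain ⟨P, hP⟩ := h
    refine ⟨P.totalDegree, 1, fun _ α => MvPolynomial.coeff (Finsupp.equivFunOnFinite.symm α) P,
      ?_, fun z => ?_⟩
    · intro _ α hα
      have := MvPolynomial.le_totalDegree (MvPolynomial.mem_support_iff.2 hα)
      rw [Finsupp.sum_fintype _ _ (by simp)] at this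
      exact this
    · simp [aux_hpeval, hP]
  | zero => exact ⟨0, 0, fun j => j.elim0, fun j => j.elim0, fun z => by simp⟩
  | add a b _ _ ha hb =>
    obtain ⟨d, r, p, h1, h2⟩ := ha
    obtain ⟨d', r', p', h1', h2'⟩ := hb
    refine ⟨max d d', r + r', Fin.append p p', ?_, fun z => ?_⟩
    · intro j
      refine Fin.addCases (fun i => ?_) (fun i => ?_) j
      · intro α h
        rw [Fin.append_left] at h
        exact le_max_of_le_left (h1 i α h)
      · intro α h
        rw [Fin.append_right] at h
        exact le_max_of_le_right (h1' i α h)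
    · rw [Fin.sum_univ_add, Pi.add_apply, h2, h2']
      simp

theorem aux_diff {n : ℕ} (a : MvPolynomial (Fin n ⊕ Fin n) ℝ) :
    ∃ σ ∈ auxSig n, ∃ τ ∈ auxSig n, aux_ev n a = σ - τ := by
  induction a using MvPolynomial.induction_on with
  | C r =>
    refine ⟨_, auxSig_const (max r 0) (le_max_right _ _), _, auxSig_const (max (-r) 0)
      (le_max_right _ _), ?_⟩
    funext z
    rw [aux_ev_C, Pi.sub_apply]
    exact (max_zero_sub_max_neg_zero_eq_self r).symm
  | add p q hp hq =>
    obtain ⟨s, hs, t, ht, e⟩ := hp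
    obtain ⟨s', hs', t', ht', e'⟩ := hq
    exact ⟨s + s', add_mem hs hs', t + t', add_mem ht ht', by rw [map_add, e, e']; ring⟩
  | mul_X p i hp =>
    obtain ⟨s, hs, t, ht, e⟩ := hp
    have : ∃ σ ∈ auxSig n, ∃ τ ∈ auxSig n, aux_ev n (MvPolynomial.X i) = σ - τ := by
      rcases i with j | j
      · refine ⟨_, auxSig_sq (MvPolynomial.C (1/2) * (1 + MvPolynomial.X j)), _,
          auxSig_sq (MvPolynomial.C (1/2) * (1 - MvPolynomial.X j)), ?_⟩
        funext z
        rw [aux_ev_inl]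
        simp [Complex.normSq_apply]
        ring
      · refine ⟨_, auxSig_sq (MvPolynomial.C (1/2) * (1 - MvPolynomial.C Complex.I * MvPolynomial.X j)), _,
          auxSig_sq (MvPolynomial.C (1/2) * (1 + MvPolynomial.C Complex.I * MvPolynomial.X j)), ?_⟩
        funext z
        rw [aux_ev_inr]
        simp [Complex.normSq_apply]
        ring
    obtain ⟨s', hs', t', ht', e'⟩ := this
    exact ⟨s * s' + t * t', add_mem (mul_mem hs hs') (mul_mem ht ht'),
      s * t' + t * s', add_mem (mul_mem hs ht') (mul_mem ht hs'), by rw [map_mul, e, e']; ring⟩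

/-- The module generated by the constraints. -/
def auxM {n m : ℕ} (G : Fin m → (Fin n → ℂ) → ℝ) : Set (MvPolynomial (Fin n ⊕ Fin n) ℝ) :=
  {a | ∃ σ0 ∈ auxSig n, ∃ σ : Fin m → (Fin n → ℂ) → ℝ, (∀ i, σ i ∈ auxSig n) ∧
    aux_ev n a = σ0 + ∑ i, σ i * G i}

theorem auxM_add {n m : ℕ} (G : Fin m → (Fin n → ℂ) → ℝ) (a) (ha : a ∈ auxM G) (b)
    (hb : b ∈ auxM G) : a + b ∈ auxM G := by
  obtain ⟨s, hs, t, ht, e⟩ := ha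
  obtain ⟨s', hs', t', ht', e'⟩ := hb
  refine ⟨s + s', add_mem hs hs', fun i => t i + t' i, fun i => add_mem (ht i) (ht' i), ?_⟩
  simp_rw [map_add, e, e', add_mul, Finset.sum_add_distrib]; ring

theorem auxM_mul {n m : ℕ} (G : Fin m → (Fin n → ℂ) → ℝ) (a b) (ha : a ∈ auxM G)
    (hb : aux_ev n b ∈ auxSig n) : b * a ∈ auxM G := by
  obtain ⟨s, hs, t, ht, e⟩ := ha
  refine ⟨aux_ev n b * s, mul_mem hb hs, fun i => aux_ev n b * t i, fun i => mul_mem hb (ht i), ?_⟩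
  simp_rw [map_mul, e, mul_add, Finset.mul_sum, mul_assoc]

theorem auxM_ideal {n m : ℕ} (G : Fin m → (Fin n → ℂ) → ℝ) (i₁ i₂ : Fin m)
    (hne : i₁ ≠ i₂) (hG : G i₂ = - G i₁) (a b c) (hb : aux_ev n b = G i₁) (hc : c = b * a) :
    c ∈ auxM G := by
  obtain ⟨s, hs, t, ht, e⟩ := aux_diff a
  refine ⟨0, zero_mem _, fun i => if i = i₁ then s else if i = i₂ then t else 0, ?_, ?_⟩
  · intro i
    dsimp only
    split_ifs
    exacts [hs, ht, zero_mem _]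
  · rw [hc, map_mul, hb, e, Finset.sum_eq_add i₁ i₂ hne]
    · simp [hne.symm, hG]; ring
    · intro c _ h; simp [h.1, h.2]
    · simp
    · simp

theorem auxM_gen {n m : ℕ} (G : Fin m → (Fin n → ℂ) → ℝ) (i₁ i₂ : Fin m)
    (hne : i₁ ≠ i₂) (hG : G i₂ = - G i₁) (b) (hb : aux_ev n b = G i₁)
    (hS : ∀ z, G i₁ z = 1 - ∑ i, Complex.normSq (z i)) (u : ℂ) (hu : Complex.normSq u = 1)
    (j : Fin n) (x) (hx : ∀ z, aux_ev n x z = (u * z j).re) (a) (ha : a ∈ auxM G) :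
    (1 + x) * a ∈ auxM G := by
  have key : aux_ev n (1 + x - MvPolynomial.C (1/2) * b) ∈ auxSig n := by
    have m1 := mul_mem (auxSig_const (n := n) (1/2) (by norm_num))
      (add_mem (auxSig_sq (1 + MvPolynomial.C u * MvPolynomial.X j))
        (sum_mem (t := Finset.univ.erase j) (fun i _ => auxSig_sq (MvPolynomial.X (R := ℂ) i))))
    convert m1 using 1
    funext z
    have hsum := Finset.add_sum_erase Finset.univ (fun i => Complex.normSq (z i)) (Finset.mem_univ j)
    have hsq : Complex.normSq (1 + u * z j) = 1 + Complex.normSq (z j) + 2 * (u * z j).re := by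
      rw [Complex.normSq_add]; simp [hu]
    simp only [map_sub, map_add, map_mul, map_one, Pi.sub_apply, Pi.add_apply, Pi.mul_apply,
      Pi.one_apply, hx, hb, hS, aux_ev_C, Finset.sum_apply, MvPolynomial.eval_X,
      MvPolynomial.eval_C, hsq]
    rw [← hsum]; ring
  have h1 := auxM_mul G a _ ha key
  have h2 := auxM_ideal G i₁ i₂ hne hG (MvPolynomial.C (1/2) * a) b _ hb rfl
  have := auxM_add G _ h1 _ h2
  convert this using 1
  ring

/-- D'Angelo's and Putinar's Positivstellensatz: if two of the constraints are `s` and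
`−s` with `s(z) = 1 − |z₁|² − ⋯ − |zₙ|²` (so that `K` lies on the unit sphere) and `f`
is positive on `K`, then `f = Σ_{i=0}^m σ_i g_i` with each `σ_i` a sum of squared
moduli of holomorphic polynomials. -/
theorem stmt6 (n m : ℕ) (f : MIdx n → MIdx n → ℂ) (k : ℕ)
    (g : Fin m → MIdx n → MIdx n → ℂ) (kk : Fin m → ℕ)
    (hf : IsPolyDeg k f) (hftop : HasTopDeg k f)
    (hg : ∀ i, IsPolyDeg (kk i) (g i)) (hgtop : ∀ i, HasTopDeg (kk i) (g i))
    (hsphere : ∃ i₁ i₂ : Fin m, i₁ ≠ i₂ ∧ g i₁ = spherePoly n 1 ∧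
      (∀ α β, g i₂ α β = -(spherePoly n 1 α β)))
    (hpos : ∀ z ∈ Kset g, 0 < peval f z) :
    ∃ (σ0 : (Fin n → ℂ) → ℝ) (σ : Fin m → (Fin n → ℂ) → ℝ),
      IsSOS σ0 ∧ (∀ i, IsSOS (σ i)) ∧
      ∀ z, peval f z = σ0 z + ∑ i, σ i z * peval (g i) z := by
  obtain ⟨i₁, i₂, hne, hg1, hg2⟩ := hsphere
  choose P hP using fun i => aux_poly (g i) (hg i)
  obtain ⟨F, hF⟩ := aux_poly f hf
  let G : Fin m → (Fin n → ℂ) → ℝ := fun i z => peval (g i) z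
  have hPG : ∀ i, aux_ev n (P i) = G i := fun i => funext (hP i)
  have hS : ∀ z, G i₁ z = 1 - ∑ i, Complex.normSq (z i) := by
    intro z; simp only [G]; rw [hg1, aux_sphere]
  have hG : G i₂ = - G i₁ := by
    funext z
    simp only [G, Pi.neg_apply]
    rw [hg1]; exact aux_peval_neg _ _ hg2 z
  have h1M : (1 : MvPolynomial (Fin n ⊕ Fin n) ℝ) ∈ auxM G :=
    ⟨1, one_mem _, fun _ => 0, fun _ => zero_mem _, by simp⟩
  have main : F ∈ auxM G := by
    refine aux_abs (Set.range MvPolynomial.X) MvPolynomial.adjoin_range_X (auxM G)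
      (auxM_add G) ?_ h1M ?_ F ?_
    · intro r hr a ha
      rw [MvPolynomial.smul_eq_C_mul]
      refine auxM_mul G a _ ha ?_
      have : aux_ev n (MvPolynomial.C r) = fun _ => r := funext (aux_ev_C n r)
      rw [this]; exact auxSig_const r hr
    · rintro _ ⟨j | j, rfl⟩ a ha
      · refine ⟨auxM_gen G i₁ i₂ hne hG _ (hPG i₁) hS 1 (by simp) j _ (fun z => ?_) a ha, ?_⟩
        · rw [aux_ev_inl]; simp
        · rw [sub_eq_add_neg]
          refine auxM_gen G i₁ i₂ hne hG _ (hPG i₁) hS (-1) (by simp) j _ (fun z => ?_) a ha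
          rw [map_neg, Pi.neg_apply, aux_ev_inl]; simp
      · refine ⟨auxM_gen G i₁ i₂ hne hG _ (hPG i₁) hS (-Complex.I) (by simp) j _ (fun z => ?_) a ha, ?_⟩
        · rw [aux_ev_inr]; simp
        · rw [sub_eq_add_neg]
          refine auxM_gen G i₁ i₂ hne hG _ (hPG i₁) hS Complex.I (by simp) j _ (fun z => ?_) a ha
          rw [map_neg, Pi.neg_apply, aux_ev_inr]; simp
    · intro φ hφ
      let z : Fin n → ℂ := fun j =>
        ⟨φ (MvPolynomial.X (Sum.inl j)), φ (MvPolynomial.X (Sum.inr j))⟩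
      have hz : ∀ a, φ a = aux_ev n a z := by
        have : φ = (Pi.evalAlgHom ℝ (fun _ : Fin n → ℂ => ℝ) z).comp (aux_ev n) := by
          apply MvPolynomial.algHom_ext
          rintro (j | j)
          · simp [aux_ev_inl, z]
          · simp [aux_ev_inr, z]
        intro a
        exact DFunLike.congr_fun this a
      rw [hz, hF]
      apply hpos
      intro i
      rw [← hP, ← hz]
      apply hφ
      refine ⟨0, zero_mem _, fun j => if j = i then 1 else 0, fun j => ?_, ?_⟩
      · dsimp only
        split_ifs
        exacts [one_mem _, zero_mem _]
      · rw [hPG]; simp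
  obtain ⟨s, hs, t, ht, e⟩ := main
  refine ⟨s, t, aux_isSOS s hs, fun i => aux_isSOS _ (ht i), fun z => ?_⟩
  rw [← hF, e]
  simp [G]
end
end

section
/- Under the sphere assumption and with K nonempty, the non-decreasing sequences (ρ_d*)_{d ≥ d^min} and (ρ_d)_{d ≥ d^min} both converge to f^opt as d → ∞. -/
open scoped BigOperators ComplexOrder
open Classical Filter

noncomputable section

theorem posst_abstract {A : Type*} [CommRing A] [Algebra ℝ A] (M : Set A)
    (hadd : ∀ a ∈ M, ∀ b ∈ M, a + b ∈ M)
    (hsmul : ∀ c : ℝ, 0 ≤ c → ∀ a ∈ M, c • a ∈ M)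
    (h1 : (1 : A) ∈ M) (hneg : (-1 : A) ∉ M)
    (harch : ∀ a : A, ∃ N : ℝ, ∀ m ∈ M, (N • (1 : A) + a) * m ∈ M)
    (f : A) (hf : ∀ φ : A →ₐ[ℝ] ℝ, (∀ m ∈ M, 0 ≤ φ m) → 0 < φ f) : f ∈ M := by
  by_contra hfM
  have harch1 : ∀ a : A, ∃ N : ℝ, N • (1 : A) + a ∈ M := fun a => by
    obtain ⟨N, hN⟩ := harch a
    exact ⟨N, by simpa using hN 1 h1⟩
  have h0 : (0 : A) ∈ M := by simpa using hsmul 0 le_rfl 1 h1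
  have h10 : (1 : A) ≠ 0 := by
    intro h; apply hneg; rw [h]; simpa using h0
  have hnegc : ∀ c : ℝ, c < 0 → c • (1 : A) ∉ M := by
    intro c hc h
    apply hneg
    have h2 : (0:ℝ) ≤ (-c)⁻¹ := inv_nonneg.2 (by linarith)
    have := hsmul (-c)⁻¹ h2 _ h
    rw [smul_smul, inv_neg, neg_mul, inv_mul_cancel₀ hc.ne] at this
    simpa using this
  -- separation
  obtain ⟨l0, hl01, hl0M, hl0f⟩ : ∃ l : A →ₗ[ℝ] ℝ, l 1 = 1 ∧ (∀ m ∈ M, 0 ≤ l m) ∧ l f ≤ 0 := by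
    let C : PointedCone ℝ A :=
      { carrier := {x | ∃ m ∈ M, ∃ c : ℝ, 0 ≤ c ∧ x = m - c • f}
        zero_mem' := ⟨0, h0, 0, le_rfl, by simp⟩
        smul_mem' := by
          rintro ⟨c, hc⟩ x ⟨m, hm, b, hb, rfl⟩
          refine ⟨c • m, hsmul c hc m hm, c * b, by positivity, ?_⟩
          show c • (m - b • f) = _
          rw [smul_sub, mul_smul]
        add_mem' := by
          rintro x y ⟨m, hm, b, hb, rfl⟩ ⟨m', hm', b', hb', rfl⟩
          refine ⟨m + m', hadd _ hm _ hm', b + b', by positivity, ?_⟩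
          rw [add_smul]; abel }
    obtain ⟨l, hl, hlC⟩ := riesz_extension C (LinearPMap.mkSpanSingleton (σ := RingHom.id ℝ) (1 : A) (1 : ℝ) h10)
      (by
        rintro ⟨x, hx⟩ hxC
        obtain ⟨a, rfl⟩ := Submodule.mem_span_singleton.1 hx
        have hap : (LinearPMap.mkSpanSingleton (σ := RingHom.id ℝ) (1 : A) (1 : ℝ) h10) ⟨a • (1:A), hx⟩ = a • (1:ℝ) := LinearPMap.mkSpanSingleton'_apply _ _ _ _ _
        rw [hap]
        obtain ⟨m, hm, c, hc, he⟩ := hxC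
        replace he : a • (1:A) = m - c • f := he
        simp only [smul_eq_mul, mul_one]
        by_contra! ha
        rcases hc.eq_or_lt with rfl | hc
        · apply hnegc a ha
          rw [he]; simpa using hm
        · apply hfM
          have : f = c⁻¹ • (m + (-a) • (1:A)) := by
            rw [eq_inv_smul_iff₀ hc.ne', neg_smul]
            rw [he]; abel
          rw [this]
          exact hsmul _ (by positivity) _ (hadd _ hm _ (hsmul _ (by linarith) _ h1)))
      (by
        intro y
        obtain ⟨N, hN⟩ := harch1 y
        refine ⟨⟨N • 1, Submodule.mem_span_singleton.2 ⟨N, rfl⟩⟩, ⟨_, hN, 0, le_rfl, by simp⟩⟩)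
    refine ⟨l, ?_, fun m hm => hlC m ⟨m, hm, 0, le_rfl, by simp⟩, ?_⟩
    · have := hl ⟨1, Submodule.mem_span_singleton_self 1⟩
      rw [this]
      have := LinearPMap.mkSpanSingleton_apply ℝ ℝ (σ := RingHom.id ℝ) h10 (1:ℝ)
      exact this
    · have := hlC (-f) ⟨0, h0, 1, zero_le_one, by simp⟩
      simpa using this
  let S : Set (A → ℝ) := {L | (∀ a b, L (a + b) = L a + L b) ∧ (∀ (c : ℝ) a, L (c • a) = c * L a) ∧
    L 1 = 1 ∧ ∀ m ∈ M, 0 ≤ L m}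
  have hSlb : ∀ a, ∃ N : ℝ, ∀ L ∈ S, -N ≤ L a := by
    intro a
    obtain ⟨N, hN⟩ := harch1 a
    refine ⟨N, fun L hL => ?_⟩
    have := hL.2.2.2 _ hN
    rw [hL.1, hL.2.1, hL.2.2.1] at this
    linarith
  have hSneg : ∀ L ∈ S, ∀ a, L (-a) = - L a := by
    intro L hL a
    have := hL.2.1 (-1) a
    simpa using this
  choose B hB using hSlb
  have hSclosed : IsClosed S := by
    have e : S = {L | ∀ a b, L (a + b) = L a + L b} ∩ ({L | ∀ (c : ℝ) a, L (c • a) = c * L a} ∩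
      ({L | L 1 = 1} ∩ {L | ∀ m ∈ M, 0 ≤ L m})) := rfl
    rw [e]
    refine IsClosed.inter ?_ (IsClosed.inter ?_ (IsClosed.inter ?_ ?_))
    · simp only [Set.ofPred_forall]
      exact isClosed_iInter fun a => isClosed_iInter fun b => isClosed_eq (by fun_prop) (by fun_prop)
    · simp only [Set.ofPred_forall]
      exact isClosed_iInter fun a => isClosed_iInter fun b => isClosed_eq (by fun_prop) (by fun_prop)
    · exact isClosed_eq (by fun_prop) (by fun_prop)
    · simp only [Set.ofPred_forall]
      exact isClosed_iInter fun a => isClosed_iInter fun b => isClosed_le (by fun_prop) (by fun_prop)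
  have hScomp : IsCompact S := by
    refine IsCompact.of_isClosed_subset (isCompact_univ_pi (fun a => isCompact_Icc (a := -B a) (b := B (-a)))) hSclosed ?_
    intro L hL a _
    have h2 := hB (-a) L hL
    rw [hSneg L hL] at h2
    exact ⟨hB a L hL, by linarith⟩
  have hSne : S.Nonempty := ⟨l0, l0.map_add, fun c a => by simp, hl01, hl0M⟩
  obtain ⟨Lm, hLm, hmin⟩ := hScomp.exists_isMinOn hSne (f := fun L => L f) (by fun_prop)
  let F : Set (A → ℝ) := {L ∈ S | ∀ L' ∈ S, L f ≤ L' f}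
  have hFexp : IsExposed ℝ S F := by
    intro _
    refine ⟨-(ContinuousLinearMap.proj f), ?_⟩
    ext L
    simp [F]
  have hFne : F.Nonempty := ⟨Lm, hLm, fun L' hL' => hmin hL'⟩
  have hFcomp : IsCompact F := hFexp.isCompact hScomp
  obtain ⟨L, hL⟩ := hFcomp.extremePoints_nonempty hFne
  have hLF : L ∈ F := hL.1
  have hLS := hFexp.isExtreme.extremePoints_subset_extremePoints hL
  have hLf : L f ≤ 0 := (hLF.2 l0 ⟨l0.map_add, fun c a => by simp, hl01, hl0M⟩).trans hl0f
  have hLin := hLF.1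
  have hmul : ∀ a b, L (a * b) = L a * L b := by
    intro a b
    obtain ⟨N1, hN1⟩ := harch a
    obtain ⟨N2, hN2⟩ := harch (-a)
    have p1 : 0 ≤ N1 + L a := by
      have := hLin.2.2.2 _ (hN1 1 h1)
      rwa [mul_one, hLin.1, hLin.2.1, hLin.2.2.1, mul_one] at this
    have p2 : 0 ≤ N2 - L a := by
      have := hLin.2.2.2 _ (hN2 1 h1)
      rwa [mul_one, hLin.1, hLin.2.1, hLin.2.2.1, mul_one, hSneg L hLin, ← sub_eq_add_neg] at this
    -- scaled functional
    have key : ∀ (c : A) (N : ℝ), (∀ m ∈ M, (N • (1 : A) + c) * m ∈ M) → 0 ≤ N + L c →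
        (fun x => (N + L c + 1)⁻¹ * (N * L x + L (c * x) + L x)) ∈ S := by
      intro c N hN hp
      have hp' : 0 < N + L c + 1 := by linarith
      refine ⟨?_, ?_, ?_, ?_⟩
      · intro x y
        simp only [mul_add, hLin.1]; ring
      · intro r x
        simp only [mul_smul_comm, hLin.2.1]; ring
      · simp only [mul_one, hLin.2.2.1]
        exact inv_mul_cancel₀ hp'.ne'
      · intro m hm
        have := hLin.2.2.2 _ (hN m hm)
        rw [add_mul, smul_mul_assoc, one_mul, hLin.1, hLin.2.1] at this
        have h3 := hLin.2.2.2 _ hm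
        exact mul_nonneg (by positivity) (by linarith)
    have k1 := key a N1 hN1 p1
    have k2 := key (-a) N2 hN2 (by rw [hSneg L hLin]; linarith)
    have hext := (mem_extremePoints.1 hLS).2 _ k1 _ k2 (by
      refine ⟨(N1 + L a + 1) / (N1 + N2 + 2), (N2 - L a + 1) / (N1 + N2 + 2), ?_, ?_, ?_, ?_⟩
      · apply div_pos <;> linarith
      · apply div_pos <;> linarith
      · rw [← add_div]; rw [div_eq_one_iff_eq] <;> linarith
      · ext x
        have q1 : N1 + L a + 1 ≠ 0 := by linarith
        have q2 : N2 + -L a + 1 ≠ 0 := by linarith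
        have q4 : N2 - L a + 1 ≠ 0 := by linarith
        have q3 : N1 + N2 + 2 ≠ 0 := by linarith
        simp only [Pi.add_apply, Pi.smul_apply, smul_eq_mul, hSneg L hLin, neg_mul]
        rw [← sub_eq_add_neg N2 (L a)]
        field_simp
        ring)
    have := congrFun hext.1 b
    have q1 : N1 + L a + 1 ≠ 0 := by linarith
    rw [inv_mul_eq_iff_eq_mul₀ q1] at this
    linarith
  let φ : A →ₐ[ℝ] ℝ := AlgHom.ofLinearMap
    { toFun := L, map_add' := hLin.1, map_smul' := fun c a => by simpa using hLin.2.1 c a }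
    hLin.2.2.1 hmul
  have := hf φ hLin.2.2.2
  have h5 : φ f = L f := rfl
  linarith

theorem finsum_deg {n l : ℕ} (h : MIdx n → ℂ) (hh : ∀ α, h α ≠ 0 → mdeg α ≤ l) :
    ∑ᶠ α, h α = ∑ a : Idx n l, h a.1 := by
  have hinj : Function.Injective (fun a : Idx n l => a.1) := Subtype.val_injective
  rw [finsum_eq_sum_of_support_subset (s := Finset.univ.image (fun a : Idx n l => a.1)) h ?_]
  · rw [Finset.sum_image (fun a _ b _ hab => hinj hab)]
  · intro α hα
    simp only [Finset.coe_image, Finset.coe_univ, Set.image_univ, Set.mem_range]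
    exact ⟨⟨α, hh α hα⟩, rfl⟩

theorem finsum_deg2 {n l : ℕ} (c : MIdx n → MIdx n → ℂ) (hc : IsPolyDeg l c)
    (w : MIdx n → MIdx n → ℂ) :
    ∑ᶠ α, ∑ᶠ β, c α β * w α β = ∑ a : Idx n l, ∑ b : Idx n l, c a.1 b.1 * w a.1 b.1 := by
  have h1 : ∀ α, ∑ᶠ β, c α β * w α β = ∑ b : Idx n l, c α b.1 * w α b.1 := fun α =>
    finsum_deg _ (fun β hβ => (hc.1 α β (left_ne_zero_of_mul hβ)).2)
  simp only [h1]
  refine finsum_deg _ (fun α hα => ?_)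
  obtain ⟨b, _, hb⟩ := Finset.exists_ne_zero_of_sum_ne_zero hα
  exact (hc.1 α _ (left_ne_zero_of_mul hb)).1

theorem peval_eq {n l : ℕ} (c : MIdx n → MIdx n → ℂ) (hc : IsPolyDeg l c) (z : Fin n → ℂ) :
    peval c z = (∑ a : Idx n l, ∑ b : Idx n l,
      c a.1 b.1 * ((starRingEnd ℂ) (mpow z a.1) * mpow z b.1)).re := by
  unfold peval
  simp only [mul_assoc]
  rw [finsum_deg2 c hc (fun α β => (starRingEnd ℂ) (mpow z α) * mpow z β)]

theorem peval_eqC {n l : ℕ} (c : MIdx n → MIdx n → ℂ) (hc : IsPolyDeg l c) (z : Fin n → ℂ) :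
    (peval c z : ℂ) = ∑ a : Idx n l, ∑ b : Idx n l,
      c a.1 b.1 * ((starRingEnd ℂ) (mpow z a.1) * mpow z b.1) := by
  rw [peval_eq c hc]
  apply Complex.conj_eq_iff_re.1
  rw [map_sum]
  simp only [map_sum, map_mul, hc.2, Complex.conj_conj]
  rw [Finset.sum_comm]
  refine Finset.sum_congr rfl fun a _ => Finset.sum_congr rfl fun b _ => by ring

abbrev Fn (n : ℕ) := (Fin n → ℂ) → ℝ

def sqHom (n : ℕ) : MvPolynomial (Fin n) ℂ →* Fn n where
  toFun q := fun z => Complex.normSq (MvPolynomial.eval z q)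
  map_one' := by ext z; simp
  map_mul' p q := by ext z; simp

def Sg (n : ℕ) : Subsemiring (Fn n) := (MonoidHom.mrange (sqHom n)).subsemiringClosure

theorem Sg_sq {n : ℕ} (q : MvPolynomial (Fin n) ℂ) : sqHom n q ∈ Sg n :=
  (Submonoid.subsemiringClosure_mem _).2 (AddSubmonoid.subset_closure ⟨q, rfl⟩)

theorem Sg_const {n : ℕ} (c : ℝ) (hc : 0 ≤ c) : (fun _ => c : Fn n) ∈ Sg n := by
  have := Sg_sq (n := n) (MvPolynomial.C (Real.sqrt c : ℂ))
  convert this using 1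
  ext z
  simp [sqHom, Complex.normSq_ofReal, hc]

theorem hpeval_mv {n : ℕ} (q : MvPolynomial (Fin n) ℂ) (z : Fin n → ℂ) :
    hpeval (fun α => q.coeff (Finsupp.equivFunOnFinite.symm α)) z = MvPolynomial.eval z q := by
  unfold hpeval
  rw [← finsum_comp_equiv (Finsupp.equivFunOnFinite : (Fin n →₀ ℕ) ≃ (Fin n → ℕ)), MvPolynomial.eval_eq']
  rw [finsum_eq_sum_of_support_subset (s := q.support)]
  · refine Finset.sum_congr rfl fun d _ => ?_
    simp [mpow]
  · intro d hd
    have := left_ne_zero_of_mul hd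
    simpa using this

theorem IsSOSUpTo.mono {n d e : ℕ} (h : d ≤ e) {σ : Fn n} (hσ : IsSOSUpTo d σ) : IsSOSUpTo e σ := by
  obtain ⟨r, p, h1, h2⟩ := hσ
  exact ⟨r, p, fun j α hα => (h1 j α hα).trans h, h2⟩

theorem IsSOSUpTo.add {n d : ℕ} {σ τ : Fn n} (hσ : IsSOSUpTo d σ) (hτ : IsSOSUpTo d τ) :
    IsSOSUpTo d (σ + τ) := by
  obtain ⟨r, p, h1, h2⟩ := hσ
  obtain ⟨r', p', h1', h2'⟩ := hτ
  refine ⟨r + r', Fin.append p p', ?_, ?_⟩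
  · intro j
    refine Fin.addCases (fun i => ?_) (fun i => ?_) j
    · simpa using h1 i
    · simpa using h1' i
  · intro z
    rw [Fin.sum_univ_add]
    simp [h2, h2']

theorem Sg_isSOS {n : ℕ} {σ : Fn n} (hσ : σ ∈ Sg n) : ∃ d, IsSOSUpTo d σ := by
  rw [Sg, Submonoid.subsemiringClosure_mem] at hσ
  induction hσ using AddSubmonoid.closure_induction with
  | mem x hx =>
    obtain ⟨q, rfl⟩ := hx
    refine ⟨q.totalDegree, 1, fun _ α => q.coeff (Finsupp.equivFunOnFinite.symm α), ?_, ?_⟩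
    · intro _ α hα
      have := MvPolynomial.le_totalDegree (MvPolynomial.mem_support_iff.2 hα)
      rw [Finsupp.sum_fintype _ _ (fun _ => rfl)] at this
      simpa [mdeg] using this
    · intro z
      simp only [hpeval_mv]
      simp [sqHom]
  | zero => exact ⟨0, 0, fun j => j.elim0, fun j => j.elim0, fun z => by simp⟩
  | add x y _ _ hx hy =>
    obtain ⟨d, hd⟩ := hx
    obtain ⟨e, he⟩ := hy
    exact ⟨max d e, (hd.mono (le_max_left _ _)).add (he.mono (le_max_right _ _))⟩

theorem Sg_nonneg {n : ℕ} {σ : Fn n} (hσ : σ ∈ Sg n) (z : Fin n → ℂ) : 0 ≤ σ z := by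
  obtain ⟨d, r, p, -, h⟩ := Sg_isSOS hσ
  rw [h]
  exact Finset.sum_nonneg fun _ _ => Complex.normSq_nonneg _

def reF {n : ℕ} (i : Fin n) : Fn n := fun z => (z i).re
def imF {n : ℕ} (i : Fin n) : Fn n := fun z => (z i).im

def Agen (n : ℕ) : Set (Fn n) := Set.range reF ∪ Set.range imF

abbrev Aalg (n : ℕ) : Subalgebra ℝ (Fn n) := Algebra.adjoin ℝ (Agen n)

/-- complex functions with real and imaginary part in `Aalg` -/
def AC (n : ℕ) : Subsemiring ((Fin n → ℂ) → ℂ) where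
  carrier := {F | (fun z => (F z).re) ∈ Aalg n ∧ (fun z => (F z).im) ∈ Aalg n}
  zero_mem' := ⟨(Aalg n).zero_mem, (Aalg n).zero_mem⟩
  one_mem' := ⟨(Aalg n).one_mem, (Aalg n).zero_mem⟩
  add_mem' {F G} hF hG := ⟨(Aalg n).add_mem hF.1 hG.1, (Aalg n).add_mem hF.2 hG.2⟩
  mul_mem' {F G} hF hG := ⟨(Aalg n).sub_mem ((Aalg n).mul_mem hF.1 hG.1) ((Aalg n).mul_mem hF.2 hG.2),
    (Aalg n).add_mem ((Aalg n).mul_mem hF.1 hG.2) ((Aalg n).mul_mem hF.2 hG.1)⟩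

theorem AC_const {n : ℕ} (c : ℂ) : (fun _ => c) ∈ AC n :=
  ⟨(Aalg n).algebraMap_mem c.re, (Aalg n).algebraMap_mem c.im⟩

theorem AC_conj {n : ℕ} {F : (Fin n → ℂ) → ℂ} (h : F ∈ AC n) :
    (fun z => (starRingEnd ℂ) (F z)) ∈ AC n :=
  ⟨h.1, (Aalg n).neg_mem h.2⟩

theorem AC_mpow {n : ℕ} (α : MIdx n) : (fun z => mpow z α) ∈ AC n := by
  have : (∏ i, (fun z : Fin n → ℂ => z i) ^ α i) ∈ AC n := by
    refine prod_mem fun i _ => pow_mem ?_ _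
    exact ⟨Algebra.subset_adjoin (Or.inl ⟨i, rfl⟩), Algebra.subset_adjoin (Or.inr ⟨i, rfl⟩)⟩
  convert this using 1
  ext z
  simp [mpow]

theorem peval_mem {n l : ℕ} (c : MIdx n → MIdx n → ℂ) (hc : IsPolyDeg l c) :
    (peval c : Fn n) ∈ Aalg n := by
  have : (∑ a : Idx n l, ∑ b : Idx n l, ((fun _ => c a.1 b.1) *
      ((fun z => (starRingEnd ℂ) (mpow z a.1)) * (fun z => mpow z b.1)))) ∈ AC n :=
    sum_mem fun a _ => sum_mem fun b _ => mul_mem (AC_const _) (mul_mem (AC_conj (AC_mpow _)) (AC_mpow _))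
  convert this.1 using 1
  ext z
  rw [peval_eq c hc]
  simp

theorem peval_sphere {n : ℕ} (R : ℝ) (z : Fin n → ℂ) :
    peval (spherePoly n R) z = R ^ 2 - ∑ i, Complex.normSq (z i) := by
  unfold peval
  have hinner : ∀ α : MIdx n, ∑ᶠ β : MIdx n,
      spherePoly n R α β * (starRingEnd ℂ) (mpow z α) * mpow z β =
      spherePoly n R α α * (starRingEnd ℂ) (mpow z α) * mpow z α := by
    intro α
    apply finsum_eq_single
    intro β hβ
    have : spherePoly n R α β = 0 := by
      unfold spherePoly
      rw [if_neg, if_neg]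
      · rintro ⟨i, rfl, rfl⟩; exact hβ rfl
      · rintro ⟨rfl, rfl⟩; exact hβ rfl
    simp [this]
  simp only [hinner]
  have hinj : Function.Injective (fun i : Fin n => (Pi.single i 1 : MIdx n)) := by
    intro i j hij
    by_contra h
    have := congrFun hij i
    simp [Pi.single_apply, h] at this
  have hne0 : ∀ i : Fin n, (Pi.single i 1 : MIdx n) ≠ 0 := by
    intro i h
    have := congrFun h i
    simp at this
  rw [finsum_eq_sum_of_support_subset (s := insert 0 (Finset.univ.image (fun i : Fin n => (Pi.single i 1 : MIdx n))))]
  · rw [Finset.sum_insert, Finset.sum_image (fun a _ b _ hab => hinj hab)]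
    · have e0 : spherePoly n R 0 0 = ((R ^ 2 : ℝ) : ℂ) := by simp [spherePoly]
      have e1 : ∀ i : Fin n, spherePoly n R (Pi.single i 1) (Pi.single i 1) = -1 := by
        intro i
        unfold spherePoly
        rw [if_neg (fun h => hne0 i h.1), if_pos ⟨i, rfl, rfl⟩]
      have e2 : ∀ i : Fin n, mpow z (Pi.single i 1) = z i := by
        intro i
        unfold mpow
        rw [Finset.prod_eq_single i]
        · simp
        · intro j _ hj; simp [Pi.single_apply, hj]
        · simp
      have e3 : mpow z 0 = 1 := by simp [mpow]
      simp only [e0, e1, e2, e3, Complex.add_re, Complex.re_sum]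
      rw [sub_eq_add_neg, ← Finset.sum_neg_distrib]
      congr 1
      · rw [map_one, mul_one, mul_one, Complex.ofReal_re]
      · refine Finset.sum_congr rfl fun i _ => ?_
        simp [Complex.normSq_apply]
    · simp only [Finset.mem_image, not_exists]
      rintro i ⟨_, h⟩
      exact hne0 i h
  · intro α hα
    have h := left_ne_zero_of_mul (left_ne_zero_of_mul hα)
    unfold spherePoly at h
    simp only [Finset.coe_insert, Finset.coe_image, Finset.coe_univ, Set.image_univ]
    by_cases h0 : α = 0
    · exact Or.inl h0
    · right
      rw [if_neg (fun h => h0 h.1)] at h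
      by_cases h2 : ∃ i : Fin n, α = Pi.single i 1 ∧ α = Pi.single i 1
      · obtain ⟨i, hi, _⟩ := h2
        exact ⟨i, hi.symm⟩
      · rw [if_neg h2] at h; exact absurd rfl h

/-- differences of sums of squares -/
def Dalg (n : ℕ) : Subalgebra ℝ (Fn n) where
  carrier := {h | ∃ a ∈ Sg n, ∃ b ∈ Sg n, h = a - b}
  add_mem' := by
    rintro _ _ ⟨a, ha, b, hb, rfl⟩ ⟨a', ha', b', hb', rfl⟩
    exact ⟨a + a', add_mem ha ha', b + b', add_mem hb hb', by ring⟩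
  mul_mem' := by
    rintro _ _ ⟨a, ha, b, hb, rfl⟩ ⟨a', ha', b', hb', rfl⟩
    exact ⟨a * a' + b * b', add_mem (mul_mem ha ha') (mul_mem hb hb'),
      a * b' + b * a', add_mem (mul_mem ha hb') (mul_mem hb ha'), by ring⟩
  algebraMap_mem' := by
    intro r
    refine ⟨_, Sg_const (max r 0) (le_max_right _ _), _, Sg_const (max (-r) 0) (le_max_right _ _), ?_⟩
    ext z
    simp only [Pi.sub_apply, Pi.algebraMap_apply, Algebra.algebraMap_self, RingHom.id_apply]
    rcases le_total r 0 with h | h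
    · rw [max_eq_right h, max_eq_left (by linarith)]; ring
    · rw [max_eq_left h, max_eq_right (by linarith)]; ring

theorem D_gen {n : ℕ} (w : ℂ) (i : Fin n) : (fun z => (w * z i).re : Fn n) ∈ Dalg n := by
  refine ⟨(fun _ => 1 / 4) * sqHom n (1 + MvPolynomial.C w * MvPolynomial.X i),
    mul_mem (Sg_const _ (by norm_num)) (Sg_sq _),
    (fun _ => 1 / 4) * sqHom n (1 - MvPolynomial.C w * MvPolynomial.X i),
    mul_mem (Sg_const _ (by norm_num)) (Sg_sq _), ?_⟩
  ext z
  simp [sqHom, Complex.normSq_apply]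
  ring

theorem A_le_D (n : ℕ) : Aalg n ≤ Dalg n := by
  apply Algebra.adjoin_le
  rintro _ (⟨i, rfl⟩ | ⟨i, rfl⟩)
  · show reF i ∈ Dalg n
    convert D_gen 1 i using 1
    ext z; simp [reF]
  · show imF i ∈ Dalg n
    convert D_gen (-Complex.I) i using 1
    ext z; simp [imF]

def Mfn {n m : ℕ} (G : Fin m → Fn n) : Set (Fn n) :=
  {h | ∃ s0 ∈ Sg n, ∃ s : Fin m → Fn n, (∀ i, s i ∈ Sg n) ∧ h = s0 + ∑ i, s i * G i}

theorem M_add {n m : ℕ} {G : Fin m → Fn n} {a b : Fn n} (ha : a ∈ Mfn G) (hb : b ∈ Mfn G) :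
    a + b ∈ Mfn G := by
  obtain ⟨s0, h0, s, hs, rfl⟩ := ha
  obtain ⟨t0, k0, t, ht, rfl⟩ := hb
  refine ⟨s0 + t0, add_mem h0 k0, fun i => s i + t i, fun i => add_mem (hs i) (ht i), ?_⟩
  simp only [add_mul, Finset.sum_add_distrib]
  ring

theorem M_mul {n m : ℕ} {G : Fin m → Fn n} {a b : Fn n} (ha : a ∈ Sg n) (hb : b ∈ Mfn G) :
    a * b ∈ Mfn G := by
  obtain ⟨t0, k0, t, ht, rfl⟩ := hb
  refine ⟨a * t0, mul_mem ha k0, fun i => a * t i, fun i => mul_mem ha (ht i), ?_⟩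
  rw [mul_add, Finset.mul_sum]
  simp only [mul_assoc]

theorem M_one {n m : ℕ} {G : Fin m → Fn n} : 1 ∈ Mfn G :=
  ⟨1, one_mem _, 0, fun _ => zero_mem _, by simp⟩

theorem M_G {n m : ℕ} {G : Fin m → Fn n} (i : Fin m) : G i ∈ Mfn G :=
  ⟨0, zero_mem _, Pi.single i 1, fun j => by
    by_cases h : j = i
    · subst h; simp [one_mem]
    · simp [h, zero_mem], by
    rw [Finset.sum_eq_single i]
    · simp
    · intro j _ hj; simp [hj]
    · simp⟩

def Good {n m : ℕ} (G : Fin m → Fn n) (a : Fn n) : Prop := ∀ x ∈ Mfn G, a * x ∈ Mfn G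

theorem Good.add {n m : ℕ} {G : Fin m → Fn n} {a b : Fn n} (ha : Good G a) (hb : Good G b) :
    Good G (a + b) := fun x hx => by rw [add_mul]; exact M_add (ha x hx) (hb x hx)

theorem Good.mul {n m : ℕ} {G : Fin m → Fn n} {a b : Fn n} (ha : Good G a) (hb : Good G b) :
    Good G (a * b) := fun x hx => by rw [mul_assoc]; exact ha _ (hb x hx)

theorem Good.smul {n m : ℕ} {G : Fin m → Fn n} {a : Fn n} (c : ℝ) (hc : 0 ≤ c) (ha : Good G a) :
    Good G (c • a) := fun x hx => by
  have : c • a * x = (fun _ => c : Fn n) * (a * x) := by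
    ext z; simp [mul_assoc]
  rw [this]
  exact M_mul (Sg_const c hc) (ha x hx)

theorem Good.one {n m : ℕ} {G : Fin m → Fn n} : Good G 1 := fun x hx => by simpa using hx

theorem good_smul_ex {n m : ℕ} {G : Fin m → Fn n} {a : Fn n}
    (h1 : ∃ N : ℝ, Good G (N • 1 + a)) (h2 : ∃ N : ℝ, Good G (N • 1 - a)) (c : ℝ) :
    ∃ N : ℝ, Good G (N • 1 + c • a) := by
  rcases le_total 0 c with hc | hc
  · obtain ⟨N, hN⟩ := h1
    refine ⟨c * N, ?_⟩
    convert hN.smul c hc using 1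
    rw [smul_add, smul_smul]
  · obtain ⟨N, hN⟩ := h2
    refine ⟨-c * N, ?_⟩
    convert hN.smul (-c) (by linarith) using 1
    rw [smul_sub, smul_smul, neg_smul c a, sub_neg_eq_add]

theorem good_mul_ex {n m : ℕ} {G : Fin m → Fn n} {a b : Fn n}
    (h1 : ∃ N : ℝ, Good G (N • 1 + a)) (h2 : ∃ N : ℝ, Good G (N • 1 - a))
    (k1 : ∃ N : ℝ, Good G (N • 1 + b)) (k2 : ∃ N : ℝ, Good G (N • 1 - b)) :
    ∃ N : ℝ, Good G (N • 1 + a * b) := by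
  have h1' := h1
  have k1' := k1
  obtain ⟨N, hN⟩ := h1'
  obtain ⟨K, hK⟩ := k1'
  obtain ⟨N2, hN2⟩ := good_smul_ex h1 h2 (-K)
  obtain ⟨K2, hK2⟩ := good_smul_ex k1 k2 (-N)
  refine ⟨N * K + N2 + K2, ?_⟩
  convert ((hN.mul hK).add hN2).add hK2 using 1
  ext z
  simp
  ring

def Balg {n m : ℕ} (G : Fin m → Fn n) : Subalgebra ℝ (Fn n) where
  carrier := {a | (∃ N : ℝ, Good G (N • 1 + a)) ∧ ∃ N : ℝ, Good G (N • 1 - a)}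
  add_mem' := by
    rintro a b ⟨⟨N1, h1⟩, ⟨N2, h2⟩⟩ ⟨⟨K1, k1⟩, ⟨K2, k2⟩⟩
    refine ⟨⟨N1 + K1, ?_⟩, ⟨N2 + K2, ?_⟩⟩
    · convert h1.add k1 using 1
      rw [add_smul]; ring
    · convert h2.add k2 using 1
      rw [add_smul]; ring
  mul_mem' := by
    rintro a b ⟨h1, h2⟩ ⟨k1, k2⟩
    refine ⟨good_mul_ex h1 h2 k1 k2, ?_⟩
    have := good_mul_ex (a := -a) (by simpa only [sub_eq_add_neg] using h2)
      (by simpa only [sub_eq_add_neg, neg_neg] using h1) k1 k2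
    simpa only [neg_mul, ← sub_eq_add_neg] using this
  algebraMap_mem' := by
    intro r
    refine ⟨⟨-r + 1, ?_⟩, ⟨r + 1, ?_⟩⟩
    · convert Good.one using 1
      ext z; simp
    · convert Good.one using 1
      ext z; simp

def sF (n : ℕ) (R : ℝ) : Fn n := fun z => R ^ 2 - ∑ i, Complex.normSq (z i)

theorem good_s {n m : ℕ} {G : Fin m → Fn n} (hG : ∀ i, G i ∈ Aalg n) (R : ℝ)
    (i₁ i₂ : Fin m) (h1 : G i₁ = sF n R) (h2 : G i₂ = -sF n R) : Good G (sF n R) := by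
  rintro x ⟨s0, h0, s, hs, rfl⟩
  have hS : ∀ a ∈ Sg n, a ∈ Dalg n := fun a ha => ⟨a, ha, 0, zero_mem _, by simp⟩
  have hx : s0 + ∑ i, s i * G i ∈ Dalg n :=
    add_mem (hS _ h0) (sum_mem fun i _ => mul_mem (hS _ (hs i)) (A_le_D n (hG i)))
  obtain ⟨a, ha, b, hb, he⟩ := hx
  rw [he]
  have := M_add (M_mul ha (M_G (G := G) i₁)) (M_mul hb (M_G (G := G) i₂))
  rw [h1, h2] at this
  convert this using 1
  ring

theorem good_gen {n m : ℕ} {G : Fin m → Fn n} (R : ℝ) (hs : Good G (sF n R))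
    (w : ℂ) (hw : Complex.normSq w = 1) (i : Fin n) :
    Good G (((R ^ 2 + 1) / 2) • 1 + fun z => (w * z i).re) := by
  have h1 : Good G (sqHom n (1 + MvPolynomial.C w * MvPolynomial.X i)
      + ∑ j ∈ Finset.univ.erase i, sqHom n (MvPolynomial.X j)) := fun x hx =>
    M_mul (add_mem (Sg_sq _) (sum_mem fun _ _ => Sg_sq _)) hx
  convert (h1.add hs).smul (1 / 2) (by norm_num) using 1
  ext z
  have e : ∑ j, Complex.normSq (z j) = Complex.normSq (z i) +
      ∑ j ∈ Finset.univ.erase i, Complex.normSq (z j) :=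
    (Finset.add_sum_erase _ _ (Finset.mem_univ i)).symm
  have e2 : Complex.normSq (1 + w * z i) = 1 + Complex.normSq (z i) + 2 * (w * z i).re := by
    rw [Complex.normSq_add, Complex.normSq_mul, hw]
    simp
  simp only [Pi.add_apply, Pi.smul_apply, Pi.one_apply, Finset.sum_apply, sF, e, sqHom,
    MonoidHom.coe_mk, OneHom.coe_mk, map_add, map_mul, map_one, MvPolynomial.eval_C,
    MvPolynomial.eval_X, e2, smul_eq_mul]
  ring

theorem A_le_B {n m : ℕ} {G : Fin m → Fn n} (R : ℝ) (hs : Good G (sF n R)) : Aalg n ≤ Balg G := by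
  apply Algebra.adjoin_le
  rintro _ (⟨i, rfl⟩ | ⟨i, rfl⟩)
  · refine ⟨⟨(R ^ 2 + 1) / 2, ?_⟩, ⟨(R ^ 2 + 1) / 2, ?_⟩⟩
    · convert good_gen R hs 1 (by simp) i using 1
      ext z; simp [reF]
    · convert good_gen R hs (-1) (by simp) i using 1
      ext z; simp [reF]; ring
  · refine ⟨⟨(R ^ 2 + 1) / 2, ?_⟩, ⟨(R ^ 2 + 1) / 2, ?_⟩⟩
    · convert good_gen R hs (-Complex.I) (by simp) i using 1
      ext z; simp [imF]
    · convert good_gen R hs (Complex.I) (by simp) i using 1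
      ext z; simp [imF]; ring

theorem posst {n m : ℕ} {G : Fin m → Fn n} (hG : ∀ i, G i ∈ Aalg n) (R : ℝ)
    (i₁ i₂ : Fin m) (h1 : G i₁ = sF n R) (h2 : G i₂ = -sF n R)
    (hne : ∃ z, ∀ i, 0 ≤ G i z) (f : Fn n) (hf : f ∈ Aalg n)
    (hpos : ∀ z, (∀ i, 0 ≤ G i z) → 0 < f z) : f ∈ Mfn G := by
  have hB := A_le_B R (good_s hG R i₁ i₂ h1 h2)
  refine posst_abstract (A := Aalg n) {a | (a : Fn n) ∈ Mfn G} ?_ ?_ ?_ ?_ ?_ ⟨f, hf⟩ ?_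
  · intro a ha b hb
    exact M_add ha hb
  · intro c hc a ha
    have := Good.one.smul c hc (a : Fn n) ha
    simpa using this
  · exact M_one
  · rintro ⟨s0, h0, s, hs, he⟩
    obtain ⟨z, hz⟩ := hne
    have := congrFun he z
    have h3 := Sg_nonneg h0 z
    have h4 : 0 ≤ ∑ i, s i z * G i z :=
      Finset.sum_nonneg fun i _ => mul_nonneg (Sg_nonneg (hs i) z) (hz i)
    simp at this
    linarith
  · intro a
    obtain ⟨N, hN⟩ := (hB a.2).1
    exact ⟨N, fun x hx => hN x hx⟩
  · intro φ hφ
    let z : Fin n → ℂ := fun i =>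
      ⟨φ ⟨reF i, Algebra.subset_adjoin (Or.inl ⟨i, rfl⟩)⟩, φ ⟨imF i, Algebra.subset_adjoin (Or.inr ⟨i, rfl⟩)⟩⟩
    let ψ : Aalg n →ₐ[ℝ] ℝ := (Pi.evalAlgHom ℝ (fun _ : Fin n → ℂ => ℝ) z).comp (Aalg n).val
    have : φ = ψ := by
      apply AlgHom.adjoin_ext
      rintro _ (⟨i, rfl⟩ | ⟨i, rfl⟩) <;> rfl
    have hz : ∀ i, 0 ≤ G i z := by
      intro i
      have h5 := hφ ⟨G i, hG i⟩ (M_G i)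
      rw [this] at h5
      exact h5
    rw [this]
    exact hpos z hz

theorem mpow_add {n : ℕ} (z : Fin n → ℂ) (α β : MIdx n) : mpow z (α + β) = mpow z α * mpow z β := by
  simp [mpow, pow_add, Finset.prod_mul_distrib]

theorem mpow_mulSingle {n : ℕ} (i : Fin n) (c : ℂ) (α : MIdx n) :
    mpow (Pi.mulSingle i c) α = c ^ α i := by
  unfold mpow
  rw [Finset.prod_eq_single i]
  · simp
  · intro j _ hj; simp [hj]
  · simp

def eHom {n : ℕ} (p : MIdx n × MIdx n) : (Fin n → ℂ) →* ℂ where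
  toFun z := (starRingEnd ℂ) (mpow z p.1) * mpow z p.2
  map_one' := by simp [mpow]
  map_mul' z w := by
    simp only [mpow, Pi.mul_apply, mul_pow, Finset.prod_mul_distrib, map_mul]
    ring

theorem pow_conj_inj {a b a' b' : ℕ}
    (h : ∀ c : ℂ, (starRingEnd ℂ) (c ^ a) * c ^ b = (starRingEnd ℂ) (c ^ a') * c ^ b') :
    a = a' ∧ b = b' := by
  have h1 : a + b = a' + b' := by
    have h2 := h 2
    simp only [map_pow, Complex.conj_ofNat, ← pow_add] at h2
    have h3 : (2 : ℕ) ^ (a + b) = 2 ^ (a' + b') := by exact_mod_cast h2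
    exact Nat.pow_right_injective le_rfl h3
  have h2 := h (Complex.exp Complex.I)
  simp only [map_pow, ← Complex.exp_conj, Complex.conj_I, ← Complex.exp_nat_mul, ← Complex.exp_add] at h2
  obtain ⟨k, hk⟩ := Complex.exp_eq_exp_iff_exists_int.1 h2
  have h3 := congrArg Complex.im hk
  simp at h3
  by_cases hk0 : k = 0
  · subst hk0
    simp at h3
    have h4 : (a : ℝ) + b = a' + b' := by exact_mod_cast h1
    have h5 : (a : ℝ) = a' := by linarith
    have h6 : (b : ℝ) = b' := by linarith
    exact ⟨by exact_mod_cast h5, by exact_mod_cast h6⟩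
  · exfalso
    apply irrational_pi
    refine ⟨((-(a : ℚ) + b) - (-a' + b')) / (2 * k), ?_⟩
    have hk1 : (k : ℝ) ≠ 0 := by exact_mod_cast hk0
    push_cast
    rw [div_eq_iff (by positivity)]
    linarith

theorem eHom_inj {n : ℕ} : Function.Injective (eHom (n := n)) := by
  rintro ⟨α, β⟩ ⟨α', β'⟩ h
  have : ∀ i, α i = α' i ∧ β i = β' i := by
    intro i
    apply pow_conj_inj
    intro c
    have := DFunLike.congr_fun h (Pi.mulSingle i c)
    simpa only [eHom, MonoidHom.coe_mk, OneHom.coe_mk, mpow_mulSingle] using this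
  rw [Prod.mk.injEq]
  exact ⟨funext fun i => (this i).1, funext fun i => (this i).2⟩

theorem exists_functional {n : ℕ} (y : MIdx n → MIdx n → ℂ) :
    ∃ Λ : ((Fin n → ℂ) → ℂ) →ₗ[ℂ] ℂ, ∀ α β, Λ (eHom (α, β)) = y α β := by
  have hLI : LinearIndependent ℂ (fun p : MIdx n × MIdx n => (eHom p : (Fin n → ℂ) → ℂ)) :=
    (linearIndependent_monoidHom (Fin n → ℂ) ℂ).comp _ eHom_inj
  let b := Module.Basis.span hLI
  obtain ⟨Λ, hΛ⟩ := LinearMap.exists_extend (b.constr ℂ (fun p : MIdx n × MIdx n => y p.1 p.2))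
  refine ⟨Λ, fun α β => ?_⟩
  have h1 := b.constr_basis ℂ (fun p : MIdx n × MIdx n => y p.1 p.2) (α, β)
  rw [← hΛ] at h1
  rw [LinearMap.comp_apply, Submodule.subtype_apply, Module.Basis.span_apply] at h1
  exact h1

theorem normSq_expand {n e : ℕ} (p : MIdx n → ℂ) (hp : ∀ α, p α ≠ 0 → mdeg α ≤ e) (z : Fin n → ℂ) :
    (Complex.normSq (hpeval p z) : ℂ) =
      ∑ a : Idx n e, ∑ b : Idx n e, (starRingEnd ℂ) (p a.1) * p b.1 * eHom (a.1, b.1) z := by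
  have : hpeval p z = ∑ a : Idx n e, p a.1 * mpow z a.1 :=
    finsum_deg _ fun α hα => hp α (left_ne_zero_of_mul hα)
  rw [Complex.normSq_eq_conj_mul_self, this, map_sum, Finset.sum_mul_sum]
  refine Finset.sum_congr rfl fun a _ => Finset.sum_congr rfl fun b _ => ?_
  simp only [map_mul, eHom, MonoidHom.coe_mk, OneHom.coe_mk]
  ring

theorem L_normSq {n e : ℕ} {y : MIdx n → MIdx n → ℂ} {Λ : ((Fin n → ℂ) → ℂ) →ₗ[ℂ] ℂ}
    (hΛ : ∀ α β, Λ (eHom (α, β)) = y α β) (p : MIdx n → ℂ) (hp : ∀ α, p α ≠ 0 → mdeg α ≤ e)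
    (hM : (momMatrixId n e y).PosSemidef) :
    0 ≤ Λ (fun z => (Complex.normSq (hpeval p z) : ℂ)) := by
  have h1 : (fun z => (Complex.normSq (hpeval p z) : ℂ)) =
      ∑ a : Idx n e, ∑ b : Idx n e, ((starRingEnd ℂ) (p a.1) * p b.1) • (eHom (a.1, b.1) : (Fin n → ℂ) → ℂ) := by
    ext z
    rw [normSq_expand p hp]
    simp [Finset.sum_apply]
  have h2 := hM.dotProduct_mulVec_nonneg (fun a => p a.1)
  rw [h1]
  simp only [map_sum, map_smul, hΛ]
  convert h2 using 1
  simp only [dotProduct, Matrix.mulVec, Finset.mul_sum, momMatrixId, Matrix.of_apply, Pi.star_apply]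
  refine Finset.sum_congr rfl fun a _ => Finset.sum_congr rfl fun b _ => ?_
  simp only [smul_eq_mul, RCLike.star_def]
  ring

theorem L_loc {n e l : ℕ} {y : MIdx n → MIdx n → ℂ} {Λ : ((Fin n → ℂ) → ℂ) →ₗ[ℂ] ℂ}
    (hΛ : ∀ α β, Λ (eHom (α, β)) = y α β) (p : MIdx n → ℂ) (hp : ∀ α, p α ≠ 0 → mdeg α ≤ e)
    (g : MIdx n → MIdx n → ℂ) (hg : IsPolyDeg l g)
    (hM : (momMatrix n e g y).PosSemidef) :
    0 ≤ Λ (fun z => (Complex.normSq (hpeval p z) : ℂ) * (peval g z : ℂ)) := by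
  have h1 : (fun z => (Complex.normSq (hpeval p z) : ℂ) * (peval g z : ℂ)) =
      ∑ a : Idx n e, ∑ b : Idx n e, ((starRingEnd ℂ) (p a.1) * p b.1) •
        ∑ c : Idx n l, ∑ d : Idx n l, g c.1 d.1 •
          (eHom (a.1 + c.1, b.1 + d.1) : (Fin n → ℂ) → ℂ) := by
    ext z
    rw [normSq_expand p hp, peval_eqC g hg]
    simp only [Finset.sum_apply, Pi.smul_apply, smul_eq_mul, Finset.sum_mul]
    refine Finset.sum_congr rfl fun a _ => Finset.sum_congr rfl fun b _ => ?_
    rw [mul_assoc]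
    congr 1
    rw [Finset.mul_sum]
    refine Finset.sum_congr rfl fun c _ => ?_
    rw [Finset.mul_sum]
    refine Finset.sum_congr rfl fun d _ => ?_
    simp only [eHom, MonoidHom.coe_mk, OneHom.coe_mk, mpow_add, map_mul]
    ring
  have h2 := hM.dotProduct_mulVec_nonneg (fun a => p a.1)
  rw [h1]
  simp only [map_sum, map_smul, hΛ]
  convert h2 using 1
  simp only [dotProduct, Matrix.mulVec, Finset.mul_sum, momMatrix, Matrix.of_apply, Pi.star_apply]
  refine Finset.sum_congr rfl fun a _ => Finset.sum_congr rfl fun b _ => ?_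
  rw [momEntry, finsum_deg2 g hg (fun γ δ => y (a.1 + γ) (b.1 + δ))]
  simp only [smul_eq_mul, RCLike.star_def]
  ring

theorem weak_duality {n m d k : ℕ} {f : MIdx n → MIdx n → ℂ} {g : Fin m → MIdx n → MIdx n → ℂ}
    {kk : Fin m → ℕ} (hf : IsPolyDeg k f) (hg : ∀ i, IsPolyDeg (kk i) (g i))
    {y : MIdx n → MIdx n → ℂ} (hy : MomFeas n m d g kk y) {lam : ℝ}
    (hc : SOSCert n m d f g kk lam) : lam ≤ Ly f y := by
  obtain ⟨s0, s, ⟨r0, p0, hp0, hs0⟩, hs, he⟩ := hc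
  obtain ⟨-, hy1, hy2, hy3⟩ := hy
  choose r p hp hps using hs
  obtain ⟨Λ, hΛ⟩ := exists_functional y
  have e1 : (fun z => (peval f z : ℂ)) - (lam : ℂ) • (eHom (0, 0) : (Fin n → ℂ) → ℂ) =
      ∑ j, (fun z => (Complex.normSq (hpeval (p0 j) z) : ℂ)) +
      ∑ i, ∑ j, (fun z => (Complex.normSq (hpeval (p i j) z) : ℂ) * (peval (g i) z : ℂ)) := by
    ext z
    have := congrArg (fun t : ℝ => (t : ℂ)) (he z)
    simp only [hs0, hps] at this
    push_cast at this
    simp only [Pi.sub_apply, Pi.add_apply, Finset.sum_apply, Pi.smul_apply]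
    rw [← Complex.ofReal_sum] at *
    simp only [Finset.sum_mul] at this
    rw [← this]
    simp [eHom, mpow]
  have e2 : (fun z => (peval f z : ℂ)) =
      ∑ a : Idx n k, ∑ b : Idx n k, f a.1 b.1 • (eHom (a.1, b.1) : (Fin n → ℂ) → ℂ) := by
    ext z
    rw [peval_eqC f hf]
    simp [Finset.sum_apply, eHom]
  have e3 : Λ (fun z => (peval f z : ℂ)) = ∑ᶠ α, ∑ᶠ β, f α β * y α β := by
    rw [e2, finsum_deg2 f hf y]
    simp only [map_sum, map_smul, hΛ, smul_eq_mul]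
  have e4 := congrArg Λ e1
  rw [map_sub, map_smul, hΛ, hy1, e3, map_add, map_sum, map_sum] at e4
  have e5 : 0 ≤ ∑ᶠ α, ∑ᶠ β, f α β * y α β - (lam : ℂ) • (1 : ℂ) := by
    rw [e4]
    refine add_nonneg (Finset.sum_nonneg fun j _ => L_normSq hΛ _ (hp0 j) hy2)
      (Finset.sum_nonneg fun i _ => ?_)
    rw [map_sum]
    exact Finset.sum_nonneg fun j _ => L_loc hΛ _ (hp i j) _ (hg i) (hy3 i)
  have e6 := (Complex.le_def.1 e5).1
  unfold Ly
  simp at e6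
  exact e6

theorem dirac_feas {n m d : ℕ} {g : Fin m → MIdx n → MIdx n → ℂ}
    {kk : Fin m → ℕ} (hg : ∀ i, IsPolyDeg (kk i) (g i)) {z : Fin n → ℂ} (hz : z ∈ Kset g) :
    MomFeas n m d g kk (fun α β => (starRingEnd ℂ) (mpow z α) * mpow z β) := by
  refine ⟨?_, by simp [mpow], ?_, ?_⟩
  · intro α β _ _
    simp [mul_comm]
  · exact Matrix.posSemidef_vecMulVec_star_self (fun a : Idx n d => mpow z a.1)
  · intro i
    have h1 : momMatrix n (d - kk i) (g i) (fun α β => (starRingEnd ℂ) (mpow z α) * mpow z β) =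
        (peval (g i) z : ℂ) • Matrix.vecMulVec (star (fun a : Idx n (d - kk i) => mpow z a.1))
          (fun a : Idx n (d - kk i) => mpow z a.1) := by
      ext a b
      simp only [momMatrix, Matrix.of_apply, momEntry, Matrix.smul_apply, Matrix.vecMulVec_apply,
        smul_eq_mul, Pi.star_apply, RCLike.star_def]
      rw [finsum_deg2 (g i) (hg i) (fun γ δ => (starRingEnd ℂ) (mpow z (a.1 + γ)) * mpow z (b.1 + δ)),
        peval_eqC _ (hg i)]
      simp only [Finset.sum_mul]
      refine Finset.sum_congr rfl fun c _ => Finset.sum_congr rfl fun d _ => ?_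
      simp only [mpow_add, map_mul]
      ring
    rw [h1]
    refine Matrix.PosSemidef.smul (Matrix.posSemidef_vecMulVec_star_self _) ?_
    exact_mod_cast hz i

theorem momFeas_mono {n m d e : ℕ} {g : Fin m → MIdx n → MIdx n → ℂ}
    {kk : Fin m → ℕ} (h : d ≤ e) {y : MIdx n → MIdx n → ℂ} (hy : MomFeas n m e g kk y) :
    MomFeas n m d g kk y := by
  obtain ⟨h1, h2, h3, h4⟩ := hy
  refine ⟨fun α β ha hb => h1 α β (ha.trans h) (hb.trans h), h2, ?_, fun i => ?_⟩
  · exact h3.submatrix (fun a : Idx n d => (⟨a.1, a.2.trans h⟩ : Idx n e))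
  · exact (h4 i).submatrix (fun a : Idx n (d - kk i) =>
      (⟨a.1, a.2.trans (Nat.sub_le_sub_right h _)⟩ : Idx n (e - kk i)))

theorem cert_mono {n m d e : ℕ} {f : MIdx n → MIdx n → ℂ} {g : Fin m → MIdx n → MIdx n → ℂ}
    {kk : Fin m → ℕ} (h : d ≤ e) {lam : ℝ} (hc : SOSCert n m d f g kk lam) :
    SOSCert n m e f g kk lam := by
  obtain ⟨s0, s, h0, hs, he⟩ := hc
  exact ⟨s0, s, h0.mono h, fun i => (hs i).mono (Nat.sub_le_sub_right h _), he⟩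

theorem cert_exists {n m k : ℕ} {f : MIdx n → MIdx n → ℂ} {g : Fin m → MIdx n → MIdx n → ℂ}
    {kk : Fin m → ℕ} (hf : IsPolyDeg k f) (hg : ∀ i, IsPolyDeg (kk i) (g i))
    (hne : (Kset g).Nonempty) {R : ℝ} (hsphere : SphereAssumption n m g R) {lam : ℝ}
    (hpos : ∀ z ∈ Kset g, lam < peval f z) : ∃ d, SOSCert n m d f g kk lam := by
  obtain ⟨-, i₁, i₂, -, h1, h2⟩ := hsphere
  have hs1 : (peval (g i₁) : Fn n) = sF n R := by
    ext z; rw [h1, peval_sphere]; rfl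
  have hs2 : (peval (g i₂) : Fn n) = -sF n R := by
    ext z
    rw [← hs1, h1]
    simp only [peval, h2, Pi.neg_apply, neg_mul, finsum_neg_distrib, Complex.neg_re]
  have hm := posst (G := fun i => peval (g i)) (fun i => peval_mem _ (hg i)) R i₁ i₂ hs1 hs2 hne
    (peval f - algebraMap ℝ (Fn n) lam)
    ((Aalg n).sub_mem (peval_mem f hf) ((Aalg n).algebraMap_mem lam))
    (fun z hz => by simpa using hpos z hz)
  obtain ⟨s0, h0, s, hs, he⟩ := hm
  obtain ⟨d0, hd0⟩ := Sg_isSOS h0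
  choose dd hdd using fun i => Sg_isSOS (hs i)
  refine ⟨max d0 (Finset.univ.sup fun i => dd i + kk i), s0, s, hd0.mono (le_max_left _ _),
    fun i => (hdd i).mono ?_, fun z => ?_⟩
  · have : dd i + kk i ≤ Finset.univ.sup fun i => dd i + kk i :=
      Finset.le_sup (f := fun i => dd i + kk i) (Finset.mem_univ i)
    have := this.trans (le_max_right d0 _)
    omega
  · simpa using congrFun he z

/-- Under the sphere assumption and with `K` nonempty, the non-decreasing sequences
`(ρ_d*)` and `(ρ_d)` both converge to `f^opt`. -/
theorem stmt8 (n m : ℕ) (f : MIdx n → MIdx n → ℂ) (k : ℕ)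
    (g : Fin m → MIdx n → MIdx n → ℂ) (kk : Fin m → ℕ)
    (hf : IsPolyDeg k f) (hftop : HasTopDeg k f)
    (hg : ∀ i, IsPolyDeg (kk i) (g i)) (hgtop : ∀ i, HasTopDeg (kk i) (g i))
    (dmin : ℕ) (hdmin : dmin = max k (Finset.univ.sup kk))
    (hK : IsCompact (Kset g)) (hne : (Kset g).Nonempty)
    (R : ℝ) (hsphere : SphereAssumption n m g R) :
    (∀ d e, dmin ≤ d → d ≤ e → rhoSOS n m d f g kk ≤ rhoSOS n m e f g kk) ∧
    (∀ d e, dmin ≤ d → d ≤ e → rhoMom n m d f g kk ≤ rhoMom n m e f g kk) ∧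
    Tendsto (fun d : ℕ => rhoSOS n m d f g kk) atTop (nhds (fOpt n m f g)) ∧
    Tendsto (fun d : ℕ => rhoMom n m d f g kk) atTop (nhds (fOpt n m f g)) := by
  have hSm : ∀ d e, d ≤ e → rhoSOS n m d f g kk ≤ rhoSOS n m e f g kk := by
    intro d e h
    apply sSup_le_sSup
    rintro x ⟨lam, hl, rfl⟩
    exact ⟨lam, cert_mono h hl, rfl⟩
  have hSM : ∀ d, rhoSOS n m d f g kk ≤ rhoMom n m d f g kk := by
    intro d
    apply sSup_le
    rintro _ ⟨lam, hl, rfl⟩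
    apply le_sInf
    rintro _ ⟨y, hy, rfl⟩
    exact_mod_cast weak_duality hf hg hy hl
  have hMf : ∀ d, rhoMom n m d f g kk ≤ fOpt n m f g := by
    intro d
    apply sInf_le_sInf
    rintro _ ⟨z, hz, rfl⟩
    refine ⟨_, dirac_feas hg hz, ?_⟩
    simp only [Ly, peval, mul_assoc]
  have hlow : ∀ a < fOpt n m f g, ∀ᶠ d in atTop, a < rhoSOS n m d f g kk := by
    intro a ha
    obtain ⟨lam, h1, h2⟩ := EReal.lt_iff_exists_real_btwn.1 ha
    obtain ⟨d0, hd0⟩ := cert_exists (kk := kk) hf hg hne hsphere (lam := lam) (fun z hz => by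
      have := h2.trans_le (sInf_le ⟨z, hz, rfl⟩)
      exact_mod_cast this)
    filter_upwards [eventually_ge_atTop d0] with d hd
    exact h1.trans_le (le_sSup ⟨lam, cert_mono hd hd0, rfl⟩)
  refine ⟨fun d e _ h => hSm d e h, fun d e _ h => ?_, ?_, ?_⟩
  · apply sInf_le_sInf
    rintro _ ⟨y, hy, rfl⟩
    exact ⟨y, momFeas_mono h hy, rfl⟩
  · refine tendsto_order.2 ⟨hlow, fun a ha => Eventually.of_forall fun d => ?_⟩
    exact ((hSM d).trans (hMf d)).trans_lt ha
  · refine tendsto_order.2 ⟨fun a ha => ?_, fun a ha => Eventually.of_forall fun d => ?_⟩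
    · filter_upwards [hlow a ha] with d hd
      exact hd.trans_le (hSM d)
    · exact (hMf d).trans_lt ha
end
end

section
/- Let R > 0 and s(z) := R² − |z₁|² − ⋯ − |zₙ|². Given d ∈ ℕ* and y ∈ H_d, if M_d(y) ⪰ 0 and M_{d−1}(s y) = 0, then Tr(M_d(y)) ≤ y_{0,0} · Σ_{l=0}^d R^{2l}. -/
open scoped BigOperators ComplexOrder
open Classical Filter

noncomputable section

lemma h_single_ne {n : ℕ} (i : Fin n) : (Pi.single i 1 : MIdx n) ≠ 0 := by
  intro h
  have := congrFun h i
  simp at this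

lemma h_entry {n : ℕ} (R : ℝ) (y : MIdx n → MIdx n → ℂ) (α : MIdx n) :
    momEntry (spherePoly n R) y α α =
      ((R ^ 2 : ℝ) : ℂ) * y α α - ∑ i : Fin n, y (α + Pi.single i 1) (α + Pi.single i 1) := by
  unfold momEntry
  have h1 : ∀ γ : MIdx n, ∑ᶠ δ : MIdx n, spherePoly n R γ δ * y (α + γ) (α + δ)
      = spherePoly n R γ γ * y (α + γ) (α + γ) := by
    intro γ
    apply finsum_eq_single
    intro δ hδ
    have : spherePoly n R γ δ = 0 := by
      unfold spherePoly
      rw [if_neg, if_neg]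
      · rintro ⟨i, rfl, rfl⟩
        exact hδ rfl
      · rintro ⟨rfl, rfl⟩
        exact hδ rfl
    rw [this, zero_mul]
  simp_rw [h1]
  rw [finsum_eq_sum_of_support_subset (s := insert (0 : MIdx n)
    (Finset.univ.image (fun i : Fin n => (Pi.single i 1 : MIdx n))))]
  · rw [Finset.sum_insert, Finset.sum_image]
    · have h0 : spherePoly n R 0 0 = ((R ^ 2 : ℝ) : ℂ) := by simp [spherePoly]
      have h2 : ∀ i : Fin n, spherePoly n R (Pi.single i 1) (Pi.single i 1) = -1 := by
        intro i
        unfold spherePoly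
        rw [if_neg, if_pos ⟨i, rfl, rfl⟩]
        exact fun h => h_single_ne i h.1
      simp only [h0, h2, add_zero, neg_mul, one_mul, Finset.sum_neg_distrib, sub_eq_add_neg]
    · intro i _ j _ h
      by_contra hij
      have := congrFun h i
      simp [Pi.single_apply, hij] at this
    · simp only [Finset.mem_image, Finset.mem_univ, true_and, not_exists]
      exact fun i => h_single_ne i
  · intro γ hγ
    simp only [Finset.coe_insert, Finset.coe_image, Finset.coe_univ, Set.image_univ,
      Set.mem_insert_iff, Set.mem_range]
    by_contra hc
    push Not at hc
    apply hγ
    have : spherePoly n R γ γ = 0 := by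
      unfold spherePoly
      rw [if_neg, if_neg]
      · rintro ⟨i, h, -⟩
        exact hc.2 i h.symm
      · exact fun h => hc.1 h.1
    simp only [this, zero_mul]

/-- Multi-indices of degree exactly `l`. -/
def hLev (n l : ℕ) : Finset (MIdx n) := Finset.piAntidiag Finset.univ l

lemma h_mem {n l : ℕ} (α : MIdx n) : α ∈ hLev n l ↔ mdeg α = l := by
  simp [hLev, mdeg]

lemma h_mdeg_add {n : ℕ} (α : MIdx n) (i : Fin n) :
    mdeg (α + Pi.single i 1) = mdeg α + 1 := by
  simp [mdeg, Finset.sum_add_distrib]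

lemma h_exists {n l : ℕ} (β : MIdx n) (h : mdeg β = l + 1) :
    ∃ (α : MIdx n) (i : Fin n), mdeg α = l ∧ α + Pi.single i 1 = β := by
  have : ∃ i, β i ≠ 0 := by
    by_contra hc
    push Not at hc
    simp [mdeg, hc] at h
  obtain ⟨i, hi⟩ := this
  have e : (β - Pi.single i 1) + Pi.single i 1 = β := by
    funext j
    by_cases hj : j = i
    · subst hj
      simp
      omega
    · simp [Pi.single_apply, hj]
  refine ⟨β - Pi.single i 1, i, ?_, e⟩
  have := h_mdeg_add (β - Pi.single i 1) i
  rw [e] at this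
  omega

lemma h_step {n l : ℕ} (f : MIdx n → ℝ) (hf : ∀ β, mdeg β = l + 1 → 0 ≤ f β) :
    ∑ β ∈ hLev n (l + 1), f β ≤
      ∑ α ∈ hLev n l, ∑ i : Fin n, f (α + Pi.single i 1) := by
  have hp : ∑ α ∈ hLev n l, ∑ i : Fin n, f (α + Pi.single i 1) =
      ∑ p ∈ hLev n l ×ˢ (Finset.univ : Finset (Fin n)), f (p.1 + Pi.single p.2 1) := by
    rw [Finset.sum_product]
  rw [hp]
  rw [← Finset.sum_fiberwise_of_maps_to (s := hLev n l ×ˢ (Finset.univ : Finset (Fin n)))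
    (t := hLev n (l + 1)) (g := fun p : MIdx n × Fin n => p.1 + Pi.single p.2 1)]
  · apply Finset.sum_le_sum
    intro β hβ
    rw [h_mem] at hβ
    obtain ⟨α, i, hα, rfl⟩ := h_exists β hβ
    refine Finset.single_le_sum
      (f := fun p : MIdx n × Fin n => f (p.1 + Pi.single p.2 1)) (a := (α, i)) ?_ ?_
    · intro p hp
      rw [Finset.mem_filter] at hp
      apply hf
      rw [hp.2]
      exact hβ
    · simp [h_mem, hα]
  · intro p hp
    rw [Finset.mem_product, h_mem] at hp
    rw [h_mem, h_mdeg_add, hp.1]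

/-- If `M_d(y) ⪰ 0` and `M_{d−1}(s y) = 0` with `s(z) = R² − |z₁|² − ⋯ − |zₙ|²`, then
`Tr(M_d(y)) ≤ y_{0,0} Σ_{l=0}^d R^{2l}`. -/
theorem stmt9 (n d : ℕ) (hd : 0 < d) (R : ℝ) (hR : 0 < R)
    (y : MIdx n → MIdx n → ℂ) (hy : HermArr n d y)
    (hpsd : (momMatrixId n d y).PosSemidef)
    (hloc : momMatrix n (d - 1) (spherePoly n R) y = 0) :
    ((momMatrixId n d y).trace).re ≤
      (y 0 0).re * ∑ l ∈ Finset.range (d + 1), R ^ (2 * l) := by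
  have hnn : ∀ β : MIdx n, mdeg β ≤ d → 0 ≤ (y β β).re := by
    intro β hβ
    have h := hpsd.diag_nonneg (i := (⟨β, hβ⟩ : Idx n d))
    exact (Complex.le_def.1 h).1
  have hrel : ∀ α : MIdx n, mdeg α ≤ d - 1 →
      R ^ 2 * (y α α).re = ∑ i : Fin n, (y (α + Pi.single i 1) (α + Pi.single i 1)).re := by
    intro α hα
    have h := congrFun (congrFun hloc (⟨α, hα⟩ : Idx n (d - 1))) ⟨α, hα⟩
    have h2 : momEntry (spherePoly n R) y α α = 0 := h
    rw [h_entry, sub_eq_zero] at h2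
    have h3 := congrArg Complex.re h2
    rwa [Complex.re_ofReal_mul, Complex.re_sum] at h3
  have hlev : ∀ l, l ≤ d → ∑ α ∈ hLev n l, (y α α).re ≤ (y 0 0).re * R ^ (2 * l) := by
    intro l
    induction l with
    | zero =>
      intro _
      have : hLev n 0 = {0} := by
        ext α
        rw [h_mem]
        simp [mdeg, funext_iff]
      simp [this]
    | succ l ih =>
      intro hl
      calc ∑ α ∈ hLev n (l + 1), (y α α).re
          ≤ ∑ α ∈ hLev n l, ∑ i : Fin n,
              (y (α + Pi.single i 1) (α + Pi.single i 1)).re :=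
            h_step (fun β => (y β β).re) (fun β hβ => hnn β (by omega))
        _ = ∑ α ∈ hLev n l, R ^ 2 * (y α α).re := by
            apply Finset.sum_congr rfl
            intro α hα
            rw [h_mem] at hα
            rw [hrel α (by omega)]
        _ = R ^ 2 * ∑ α ∈ hLev n l, (y α α).re := by rw [Finset.mul_sum]
        _ ≤ R ^ 2 * ((y 0 0).re * R ^ (2 * l)) := by
            have := ih (by omega)
            gcongr
        _ = (y 0 0).re * R ^ (2 * (l + 1)) := by ring
  have htr : ((momMatrixId n d y).trace).re =
      ∑ l ∈ Finset.range (d + 1), ∑ α ∈ hLev n l, (y α α).re := by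
    have h1 : ((momMatrixId n d y).trace).re = ∑ a : Idx n d, (y a.1 a.1).re := by
      rw [Matrix.trace, Complex.re_sum]
      rfl
    rw [h1, ← Finset.sum_fiberwise_of_maps_to (s := (Finset.univ : Finset (Idx n d)))
      (t := Finset.range (d + 1)) (g := fun a => mdeg a.1)]
    · apply Finset.sum_congr rfl
      intro l hl
      rw [Finset.mem_range] at hl
      refine Finset.sum_bij (fun a _ => a.1) ?_ ?_ ?_ ?_
      · intro a ha
        rw [h_mem]
        exact (Finset.mem_filter.1 ha).2
      · intro a _ b _ h
        exact Subtype.ext h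
      · intro β hβ
        rw [h_mem] at hβ
        exact ⟨⟨β, by omega⟩, Finset.mem_filter.2 ⟨Finset.mem_univ _, hβ⟩, rfl⟩
      · intro a _
        rfl
    · intro a _
      exact Finset.mem_range.2 (Nat.lt_succ_of_le a.2)
  rw [htr, Finset.mul_sum]
  apply Finset.sum_le_sum
  intro l hl
  rw [Finset.mem_range] at hl
  exact hlev l (by omega)
end
end
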